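/- arXiv:2003.04281 — 3 statements merged into one kernel-verified Lean document; each statement's English description precedes it below -/
import Mathlib

section
/- Let K be a 3×3 complex matrix with simple spectrum. Then for all choices of a covector ⟨L| ∈ H*, a vector |R⟩ ∈ H and of the inhomogeneities ξ₁,…,ξ_N (subject to ξᵢ−ξⱼ ∉ {0,η,−η}) outside a proper algebraic subset of the parameter space, the 3^N covectors ⟨L|∏_{n=1}^N (T₁^{(K)}(ξₙ))^{hₙ}, indexed by h = (h₁,…,h_N) ∈ {0,1,2}^N, form a basis of H*, and the 3^N vectors ∏_{n=1}^N (T₁^{(K)}(ξₙ))^{hₙ}|R⟩ form a basis of H. In particular one may take the tensor-product forms ⟨L| = (⊗_{a=1}^N (x,y,z)_a)·Γ_W^{-1} and |R⟩ = Γ_W·(⊗_{a=1}^N (r,s,t)_aᵗ), which are admissible provided: in case (i) xyz ≠ 0 and rst ≠ 0; in case (ii) xz ≠ 0 and st ≠ 0; in case (iii) x ≠ 0 and t ≠ 0. -/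
open scoped BigOperators

namespace SoV

noncomputable section

/-- Quantum states of the gl₃ chain of length `N`: labels of the natural tensor basis
of `H = (ℂ³)^{⊗N}`. -/
abbrev St (N : ℕ) := Fin N → Fin 3
/-- The Hilbert space `H` (and its dual), realized as functions on basis labels. -/
abbrev Hsp (N : ℕ) := St N → ℂ
/-- Operators on `H`. -/
abbrev Op (N : ℕ) := Matrix (St N) (St N) ℂ

variable {N : ℕ}

/-- ξᵢ − ξⱼ ∉ {0, η, −η} for i ≠ j. -/
def InhomCond (η : ℂ) (ξ : Fin N → ℂ) : Prop :=
  ∀ i j : Fin N, i ≠ j → ξ i - ξ j ≠ 0 ∧ ξ i - ξ j ≠ η ∧ ξ i - ξ j ≠ -η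

/-- Vandermonde product `V(x₁,…,x_M) = ∏_{i<j} (x_j − x_i)`. -/
def Vdm {M : ℕ} (x : Fin M → ℂ) : ℂ :=
  ∏ j : Fin M, ∏ i ∈ Finset.univ.filter (fun i => i < j), (x j - x i)

/-- `d(λ) = ∏_a (λ − ξ_a)`. -/
def dfun (ξ : Fin N → ℂ) (lam : ℂ) : ℂ := ∏ a, (lam - ξ a)

/-- The quantum determinant at identity twist:
`q-det M^{(I)}(λ) = ∏_b (λ−ξ_b+η)(λ−ξ_b−η)(λ−ξ_b−2η)`. -/
def qdetI (η : ℂ) (ξ : Fin N → ℂ) (lam : ℂ) : ℂ :=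
  ∏ b, ((lam - ξ b + η) * (lam - ξ b - η) * (lam - ξ b - 2 * η))

/-- The rational gl₃ R-matrix `R_{a,n}(λ − ξ_n) = (λ−ξ_n)·Id + η·P` acting on the
auxiliary space (first factor) and the `n`-th site of the chain. -/
def Raux (η : ℂ) (ξ : Fin N → ℂ) (lam : ℂ) (n : Fin N) :
    Matrix (Fin 3 × St N) (Fin 3 × St N) ℂ := Matrix.of fun p q =>
  (lam - ξ n) * (if p = q then 1 else 0) +
    η * (if p.1 = q.2 n ∧ p.2 = Function.update q.2 n q.1 then 1 else 0)

/-- The twist matrix `K` acting on the auxiliary space. -/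
def Kaux (K : Matrix (Fin 3) (Fin 3) ℂ) :
    Matrix (Fin 3 × St N) (Fin 3 × St N) ℂ := Matrix.of fun p q =>
  K p.1 q.1 * (if p.2 = q.2 then 1 else 0)

/-- The monodromy matrix `M^{(K)}(λ) = K_a R_{a,N}(λ−ξ_N) ⋯ R_{a,1}(λ−ξ_1)`. -/
def monodromy (η : ℂ) (ξ : Fin N → ℂ) (K : Matrix (Fin 3) (Fin 3) ℂ) (lam : ℂ) :
    Matrix (Fin 3 × St N) (Fin 3 × St N) ℂ :=
  Kaux K * ((List.ofFn fun n : Fin N => Raux η ξ lam n).reverse.prod)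

/-- The transfer matrix `T₁^{(K)}(λ) = tr_a M^{(K)}(λ)`. -/
def T1 (η : ℂ) (ξ : Fin N → ℂ) (K : Matrix (Fin 3) (Fin 3) ℂ) (lam : ℂ) : Op N :=
  Matrix.of fun f g => ∑ v : Fin 3, monodromy η ξ K lam (v, f) (v, g)

/-- Embedding of an (aux ⊗ H)-operator using the first of two auxiliary spaces. -/
def emb1 (M : Matrix (Fin 3 × St N) (Fin 3 × St N) ℂ) :
    Matrix ((Fin 3 × Fin 3) × St N) ((Fin 3 × Fin 3) × St N) ℂ := Matrix.of fun p q =>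
  M (p.1.1, p.2) (q.1.1, q.2) * (if p.1.2 = q.1.2 then 1 else 0)

/-- Embedding of an (aux ⊗ H)-operator using the second of two auxiliary spaces. -/
def emb2 (M : Matrix (Fin 3 × St N) (Fin 3 × St N) ℂ) :
    Matrix ((Fin 3 × Fin 3) × St N) ((Fin 3 × Fin 3) × St N) ℂ := Matrix.of fun p q =>
  M (p.1.2, p.2) (q.1.2, q.2) * (if p.1.1 = q.1.1 then 1 else 0)

/-- The antisymmetrizer `P⁻₁₂` on the two auxiliary spaces (acting trivially on `H`). -/
def antisym2 : Matrix ((Fin 3 × Fin 3) × St N) ((Fin 3 × Fin 3) × St N) ℂ :=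
  Matrix.of fun p q =>
    (if p.2 = q.2 then 1 else 0) *
      ((2 : ℂ)⁻¹ * ((if p.1 = q.1 then 1 else 0) - (if p.1 = (q.1.2, q.1.1) then 1 else 0)))

/-- The fused transfer matrix
`T₂^{(K)}(λ) = tr_{12} [P⁻₁₂ M₁^{(K)}(λ) M₂^{(K)}(λ−η)]`. -/
def T2 (η : ℂ) (ξ : Fin N → ℂ) (K : Matrix (Fin 3) (Fin 3) ℂ) (lam : ℂ) : Op N :=
  Matrix.of fun f g => ∑ v : Fin 3 × Fin 3,
    ((antisym2 * emb1 (monodromy η ξ K lam) * emb2 (monodromy η ξ K (lam - η)) :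
      Matrix ((Fin 3 × Fin 3) × St N) ((Fin 3 × Fin 3) × St N) ℂ)) (v, f) (v, g)

/-- A matrix has simple spectrum iff its minimal and characteristic polynomials coincide. -/
def SimpleSpectrum (K : Matrix (Fin 3) (Fin 3) ℂ) : Prop := minpoly ℂ K = K.charpoly

/-- The conserved-charge product `∏_n T₂^{(K)}(ξ_n−η)^{δ_{h_n,0}} T₁^{(K)}(ξ_n)^{δ_{h_n,2}}`
generating the SoV co-vector basis. -/
def sovCovOp (η : ℂ) (ξ : Fin N → ℂ) (K : Matrix (Fin 3) (Fin 3) ℂ) (h : St N) : Op N :=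
  (List.ofFn fun n : Fin N =>
    T2 η ξ K (ξ n - η) ^ (if h n = 0 then 1 else 0) *
      T1 η ξ K (ξ n) ^ (if h n = 2 then 1 else 0)).prod

/-- The SoV co-vector `⟨h| = ⟨1| ∏_n T₂^{(K)}(ξ_n−η)^{δ_{h_n,0}} T₁^{(K)}(ξ_n)^{δ_{h_n,2}}`. -/
def sovCov (η : ℂ) (ξ : Fin N → ℂ) (K : Matrix (Fin 3) (Fin 3) ℂ) (L : Hsp N) (h : St N) :
    Hsp N := Matrix.vecMul L (sovCovOp η ξ K h)

/-- The conserved-charge product `∏_n T₂^{(K)}(ξ_n)^{δ_{h_n,1}} T₁^{(K)}(ξ_n)^{δ_{h_n,2}}`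
generating the SoV vector basis. -/
def sovVecOp (η : ℂ) (ξ : Fin N → ℂ) (K : Matrix (Fin 3) (Fin 3) ℂ) (h : St N) : Op N :=
  (List.ofFn fun n : Fin N =>
    T2 η ξ K (ξ n) ^ (if h n = 1 then 1 else 0) *
      T1 η ξ K (ξ n) ^ (if h n = 2 then 1 else 0)).prod

/-- The SoV vector `|h⟩ = ∏_n T₂^{(K)}(ξ_n)^{δ_{h_n,1}} T₁^{(K)}(ξ_n)^{δ_{h_n,2}} |0⟩`. -/
def sovVec (η : ℂ) (ξ : Fin N → ℂ) (K : Matrix (Fin 3) (Fin 3) ℂ) (R0 : Hsp N) (h : St N) :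
    Hsp N := Matrix.mulVec (sovVecOp η ξ K h) R0

/-- Pairing ⟨L|v⟩ between a co-vector and a vector. -/
def pair (L v : Hsp N) : ℂ := ∑ f, L f * v f

/-- A family of `3^N` (co-)vectors is a basis of `H`. -/
def IsBasisFamily (v : St N → Hsp N) : Prop :=
  LinearIndependent ℂ v ∧ Submodule.span ℂ (Set.range v) = ⊤

/-- The label `(0,…,0)`. -/
def zeroSt : St N := fun _ => 0

/-- `R0` is the reference vector `|0⟩`, characterized by `⟨k|0⟩ = ∏_a δ_{k_a,0}`. -/
def DualRef (η : ℂ) (ξ : Fin N → ℂ) (K : Matrix (Fin 3) (Fin 3) ℂ) (L R0 : Hsp N) : Prop :=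
  ∀ k : St N, pair (sovCov η ξ K L k) R0 = if k = zeroSt then 1 else 0

/-- The diagonal SoV coupling `N_h`. -/
def Nh (η : ℂ) (ξ : Fin N → ℂ) (h : St N) : ℂ :=
  (∏ a, dfun ξ (ξ a - η) / dfun ξ (ξ a - ((1 : ℂ) + (if h a = 0 then 0 else 1)) * η)) *
    Vdm ξ ^ 2 /
      (Vdm (fun a => ξ a - (if h a = 0 then 0 else 1 : ℂ) * η) *
        Vdm (fun a => ξ a - (if h a = 2 then 1 else 0 : ℂ) * η))

/-- The 3×3 Jordan-type matrix with diagonal `(k₀,k₁,k₂)` and superdiagonal `(y₁,y₂)`. -/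
def KJmat (k₀ k₁ k₂ y₁ y₂ : ℂ) : Matrix (Fin 3) (Fin 3) ℂ := !![k₀, y₁, 0; 0, k₁, y₂; 0, 0, k₂]

/-- `W` conjugates `K` to its Jordan form with data `(k₀,k₁,k₂,y₁,y₂)`. -/
def JordanData (K W : Matrix (Fin 3) (Fin 3) ℂ) (k₀ k₁ k₂ y₁ y₂ : ℂ) : Prop :=
  IsUnit W.det ∧ K = W * KJmat k₀ k₁ k₂ y₁ y₂ * W⁻¹

/-- The tensor product co-vector `⟨L| = (⊗_a (x,y,z)_a)·Γ_W⁻¹`. -/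
def tensorCov (W : Matrix (Fin 3) (Fin 3) ℂ) (x y z : ℂ) : Hsp N :=
  fun f => ∏ a, Matrix.vecMul ![x, y, z] W⁻¹ (f a)

/-- The tensor product vector `|R⟩ = Γ_W·(⊗_a (r,s,t)_aᵗ)`. -/
def tensorVec (W : Matrix (Fin 3) (Fin 3) ℂ) (r s t : ℂ) : Hsp N :=
  fun f => ∏ a, Matrix.mulVec W ![r, s, t] (f a)

/-- `1_k = {a : k_a = 1}`. -/
def ones (k : St N) : Finset (Fin N) := Finset.univ.filter fun a => k a = 1

/-- `n_k = ⌊#1_k / 2⌋`. -/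
def nhalf (k : St N) : ℕ := (ones k).card / 2

/-- `k_{α,β}^{(0,2)}`: the label `k` with entries in `α` set to `0` and entries in `β` set to `2`. -/
def kab (k : St N) (α β : Finset (Fin N)) : St N :=
  fun a => if a ∈ α then 0 else if a ∈ β then 2 else k a

end
end SoV

namespace SoV
noncomputable section
variable {N : ℕ}

/-- The co-vector `⟨L| ∏_n T₁^{(K)}(ξ_n)^{h_n}`. -/
def powCov (η : ℂ) (ξ : Fin N → ℂ) (K : Matrix (Fin 3) (Fin 3) ℂ) (L : Hsp N) (h : St N) :
    Hsp N :=
  Matrix.vecMul L ((List.ofFn fun n : Fin N => T1 η ξ K (ξ n) ^ (h n : ℕ)).prod)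

/-- The vector `∏_n T₁^{(K)}(ξ_n)^{h_n} |R⟩`. -/
def powVec (η : ℂ) (ξ : Fin N → ℂ) (K : Matrix (Fin 3) (Fin 3) ℂ) (R : Hsp N) (h : St N) :
    Hsp N :=
  Matrix.mulVec ((List.ofFn fun n : Fin N => T1 η ξ K (ξ n) ^ (h n : ℕ)).prod) R

/-! ### Polynomial functions -/

/-- A function of finitely or infinitely many complex variables given by a polynomial. -/
def IsPoly {σ : Type*} (f : (σ → ℂ) → ℂ) : Prop :=
  ∃ p : MvPolynomial σ ℂ, ∀ x, MvPolynomial.eval x p = f x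

namespace IsPoly

variable {σ ι : Type*}

lemma const (c : ℂ) : IsPoly fun _ : σ → ℂ => c := ⟨MvPolynomial.C c, by simp⟩

lemma coord (i : σ) : IsPoly fun x : σ → ℂ => x i := ⟨MvPolynomial.X i, by simp⟩

lemma add {f g : (σ → ℂ) → ℂ} (hf : IsPoly f) (hg : IsPoly g) : IsPoly fun x => f x + g x := by
  obtain ⟨p, hp⟩ := hf
  obtain ⟨q, hq⟩ := hg
  exact ⟨p + q, by simp [hp, hq]⟩

lemma sub {f g : (σ → ℂ) → ℂ} (hf : IsPoly f) (hg : IsPoly g) : IsPoly fun x => f x - g x := by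
  obtain ⟨p, hp⟩ := hf
  obtain ⟨q, hq⟩ := hg
  exact ⟨p - q, by simp [hp, hq]⟩

lemma mul {f g : (σ → ℂ) → ℂ} (hf : IsPoly f) (hg : IsPoly g) : IsPoly fun x => f x * g x := by
  obtain ⟨p, hp⟩ := hf
  obtain ⟨q, hq⟩ := hg
  exact ⟨p * q, by simp [hp, hq]⟩

lemma sum (s : Finset ι) {f : ι → (σ → ℂ) → ℂ} (hf : ∀ i, IsPoly (f i)) :
    IsPoly fun x => ∑ i ∈ s, f i x := by
  choose p hp using hf
  exact ⟨∑ i ∈ s, p i, by simp [hp]⟩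

lemma prod (s : Finset ι) {f : ι → (σ → ℂ) → ℂ} (hf : ∀ i, IsPoly (f i)) :
    IsPoly fun x => ∏ i ∈ s, f i x := by
  choose p hp using hf
  exact ⟨∏ i ∈ s, p i, by simp [hp]⟩

end IsPoly

/-- A matrix all of whose entries are polynomial functions. -/
def IsPolyMatrix {σ m n : Type*} (A : (σ → ℂ) → Matrix m n ℂ) : Prop :=
  ∀ i j, IsPoly fun x => A x i j

namespace IsPolyMatrix

variable {σ ι n : Type*}

lemma const (A : Matrix n n ℂ) : IsPolyMatrix fun _ : σ → ℂ => A := fun _ _ => .const _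

variable [Fintype n]

lemma mul {A B : (σ → ℂ) → Matrix n n ℂ} (hA : IsPolyMatrix A) (hB : IsPolyMatrix B) :
    IsPolyMatrix fun x => A x * B x := fun i j => by
  simp only [Matrix.mul_apply]
  exact .sum _ fun k => (hA i k).mul (hB k j)

variable [DecidableEq n]

lemma pow {A : (σ → ℂ) → Matrix n n ℂ} (hA : IsPolyMatrix A) (k : ℕ) :
    IsPolyMatrix fun x => A x ^ k := by
  induction k with
  | zero => simpa using const 1
  | succ k ih => simpa only [pow_succ] using ih.mul hA

lemma list_prod (l : List ι) {A : ι → (σ → ℂ) → Matrix n n ℂ} (hA : ∀ i, IsPolyMatrix (A i)) :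
    IsPolyMatrix fun x => (l.map fun i => A i x).prod := by
  induction l with
  | nil => simpa using const 1
  | cons i l ih => simpa only [List.map_cons, List.prod_cons] using (hA i).mul ih

lemma det {A : (σ → ℂ) → Matrix n n ℂ} (hA : IsPolyMatrix A) : IsPoly fun x => (A x).det := by
  simp only [Matrix.det_apply']
  exact .sum _ fun τ => (IsPoly.const _).mul (.prod _ fun i => hA _ _)

end IsPolyMatrix

lemma isPolyMatrix_monodromy {σ : Type*} (η : ℂ) (K : Matrix (Fin 3) (Fin 3) ℂ)
    {ξ : (σ → ℂ) → Fin N → ℂ} (hξ : ∀ n, IsPoly fun x => ξ x n) {lam : (σ → ℂ) → ℂ}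
    (hlam : IsPoly lam) : IsPolyMatrix fun x => monodromy η (ξ x) K (lam x) := by
  unfold monodromy
  refine (IsPolyMatrix.const _).mul ?_
  simp only [List.ofFn_eq_map, ← List.map_reverse]
  refine .list_prod _ fun n p q => ?_
  simp only [Raux, Matrix.of_apply]
  exact ((hlam.sub (hξ n)).mul (.const _)).add (.const _)

lemma isPolyMatrix_T1_prod {σ : Type*} (η : ℂ) (K : Matrix (Fin 3) (Fin 3) ℂ)
    {ξ : (σ → ℂ) → Fin N → ℂ} (hξ : ∀ n, IsPoly fun x => ξ x n) (h : St N) :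
    IsPolyMatrix fun x => (List.ofFn fun n => T1 η (ξ x) K (ξ x n) ^ (h n : ℕ)).prod := by
  simp only [List.ofFn_eq_map]
  refine .list_prod _ fun n => .pow (fun f g => ?_) _
  simp only [T1, Matrix.of_apply]
  exact .sum _ fun v => isPolyMatrix_monodromy η K hξ (hξ n) _ _

lemma isPoly_det_powCov {σ : Type*} (η : ℂ) (K : Matrix (Fin 3) (Fin 3) ℂ)
    {ξ : (σ → ℂ) → Fin N → ℂ} (hξ : ∀ n, IsPoly fun x => ξ x n)
    {L : (σ → ℂ) → Hsp N} (hL : ∀ f, IsPoly fun x => L x f) :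
    IsPoly fun x => (Matrix.of (powCov η (ξ x) K (L x))).det := by
  refine IsPolyMatrix.det fun h f => ?_
  simp only [Matrix.of_apply, powCov, Matrix.vecMul, dotProduct]
  exact .sum _ fun g => (hL g).mul (isPolyMatrix_T1_prod η K hξ h g f)

lemma isPoly_det_powVec {σ : Type*} (η : ℂ) (K : Matrix (Fin 3) (Fin 3) ℂ)
    {ξ : (σ → ℂ) → Fin N → ℂ} (hξ : ∀ n, IsPoly fun x => ξ x n)
    {R : (σ → ℂ) → Hsp N} (hR : ∀ f, IsPoly fun x => R x f) :
    IsPoly fun x => (Matrix.of (powVec η (ξ x) K (R x))).det := by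
  refine IsPolyMatrix.det fun h f => ?_
  simp only [Matrix.of_apply, powVec, Matrix.mulVec, dotProduct]
  exact .sum _ fun g => (isPolyMatrix_T1_prod η K hξ h f g).mul (hR g)

lemma linearIndependent_iff_det_ne_zero {n : Type*} [Fintype n] [DecidableEq n]
    (v : n → n → ℂ) : LinearIndependent ℂ v ↔ (Matrix.of v).det ≠ 0 := by
  rw [← isUnit_iff_ne_zero, ← Matrix.isUnit_iff_isUnit_det,
    ← Matrix.linearIndependent_rows_iff_isUnit]
  rfl

lemma isBasisFamily_of_det_ne_zero {v : St N → Hsp N} (hv : (Matrix.of v).det ≠ 0) :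
    IsBasisFamily v := by
  have h := (linearIndependent_iff_det_ne_zero v).2 hv
  exact ⟨h, h.span_eq_top_of_card_eq_finrank (by simp)⟩

/-! ### Products of one-site operators -/

/-- The operator `⊗_a A_a` on the chain. -/
def siteProd : (Fin N → Matrix (Fin 3) (Fin 3) ℂ) →* Op N where
  toFun A := Matrix.of fun f g => ∏ a, A a (f a) (g a)
  map_one' := by
    ext f g
    simp only [Matrix.of_apply, Pi.one_apply, Matrix.one_apply, Finset.prod_ite_zero,
      Finset.mem_univ, true_imp_iff, funext_iff, Finset.prod_const_one]
  map_mul' A B := by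
    ext f g
    simp only [Matrix.of_apply, Matrix.mul_apply, Pi.mul_apply, Finset.prod_univ_sum,
      Fintype.piFinset_univ, Finset.prod_mul_distrib]

lemma siteProd_apply (A : Fin N → Matrix (Fin 3) (Fin 3) ℂ) (f g : St N) :
    siteProd A f g = ∏ a, A a (f a) (g a) := rfl

lemma vecMul_siteProd (v : Fin 3 → ℂ) (A : Fin N → Matrix (Fin 3) (Fin 3) ℂ) (f : St N) :
    Matrix.vecMul (fun g : St N => ∏ a, v (g a)) (siteProd A) f
      = ∏ a, Matrix.vecMul v (A a) (f a) := by
  simp only [Matrix.vecMul, dotProduct, siteProd_apply, Finset.prod_univ_sum,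
      Fintype.piFinset_univ, Finset.prod_mul_distrib]

lemma siteProd_mulVec (v : Fin 3 → ℂ) (A : Fin N → Matrix (Fin 3) (Fin 3) ℂ) (f : St N) :
    Matrix.mulVec (siteProd A) (fun g : St N => ∏ a, v (g a)) f
      = ∏ a, Matrix.mulVec (A a) v (f a) := by
  simp only [Matrix.mulVec, dotProduct, siteProd_apply, Finset.prod_univ_sum,
      Fintype.piFinset_univ, Finset.prod_mul_distrib]

lemma linearIndependent_tensor {V : Matrix (Fin 3) (Fin 3) ℂ} (hV : V.det ≠ 0) :
    LinearIndependent ℂ fun h f : St N => ∏ a, V (h a) (f a) := by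
  rw [linearIndependent_iff_det_ne_zero, ← isUnit_iff_ne_zero, ← Matrix.isUnit_iff_isUnit_det]
  have hu : IsUnit V := (Matrix.isUnit_iff_isUnit_det V).2 hV.isUnit
  exact (Pi.isUnit_iff.2 fun _ : Fin N => hu).map siteProd

/-- In a product along all sites, only one factor of which is nontrivial, only that one stays. -/
lemma prod_ofFn_eq_single {M : Type*} [Monoid M] (n : Fin N) (f : Fin N → M)
    (hf : ∀ m, m ≠ n → f m = 1) : (List.ofFn f).prod = f n := by
  rw [List.ofFn_eq_map, List.prod_map_eq_pow_single n f fun m hm _ => hf m hm,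
    List.count_eq_one_of_mem (List.nodup_finRange N) (List.mem_finRange n), pow_one]

lemma reverse_prod_ofFn_eq_single {M : Type*} [Monoid M] (n : Fin N) (f : Fin N → M)
    (hf : ∀ m, m ≠ n → f m = 1) : (List.ofFn f).reverse.prod = f n := by
  rw [List.ofFn_eq_map, ← List.map_reverse,
    List.prod_map_eq_pow_single n f fun m hm _ => hf m hm, List.count_reverse,
    List.count_eq_one_of_mem (List.nodup_finRange N) (List.mem_finRange n), pow_one]

lemma prod_ofFn_mulSingle {M : Type*} [Monoid M] (x : Fin N → M) :
    (List.ofFn fun n => (Pi.mulSingle n (x n) : Fin N → M)).prod = x := by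
  funext m
  rw [Pi.list_prod_apply, List.map_ofFn, prod_ofFn_eq_single m] <;>
    simp +contextual [eq_comm]

lemma list_prod_smul {ι A : Type*} [Semiring A] [Algebra ℂ A] (l : List ι) (c : ι → ℂ)
    (f : ι → A) : (l.map fun i => c i • f i).prod = (l.map c).prod • (l.map f).prod := by
  induction l with
  | nil => simp
  | cons i l ih => simp [ih, smul_smul, mul_comm]

/-! ### The transfer matrix for widely separated inhomogeneities -/

/-- The permutation of the auxiliary space and the `n`-th site. -/
def permAux (n : Fin N) : Matrix (Fin 3 × St N) (Fin 3 × St N) ℂ :=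
  Matrix.of fun p q => if p.1 = q.2 n ∧ p.2 = Function.update q.2 n q.1 then 1 else 0

lemma Raux_eq (η : ℂ) (ξ : Fin N → ℂ) (lam : ℂ) (n : Fin N) :
    Raux η ξ lam n = (lam - ξ n) • 1 + η • permAux n := by
  ext p q
  simp [Raux, permAux, Matrix.one_apply]

/-- The trace over the auxiliary space. -/
def auxTrace : Matrix (Fin 3 × St N) (Fin 3 × St N) ℂ →ₗ[ℂ] Op N where
  toFun M := Matrix.of fun f g => ∑ v, M (v, f) (v, g)
  map_add' A B := by ext; simp [Finset.sum_add_distrib]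
  map_smul' c A := by ext; simp [Finset.mul_sum]

lemma T1_eq (η : ℂ) (ξ : Fin N → ℂ) (K : Matrix (Fin 3) (Fin 3) ℂ) (lam : ℂ) :
    T1 η ξ K lam = auxTrace (monodromy η ξ K lam) := rfl

lemma auxTrace_Kaux_mul_permAux (K : Matrix (Fin 3) (Fin 3) ℂ) (n : Fin N) :
    auxTrace (Kaux K * permAux n) = siteProd (Pi.mulSingle n K) := by
  ext f g
  have h1 : auxTrace (Kaux K * permAux n) f g
      = ∑ v, K v (g n) * (if f = Function.update g n v then 1 else 0) := by
    change ∑ v, (Kaux K * permAux n : Matrix (Fin 3 × St N) (Fin 3 × St N) ℂ) (v, f) (v, g) = _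
    refine Finset.sum_congr rfl fun v _ => ?_
    simp only [Matrix.mul_apply, Fintype.sum_prod_type, Kaux, permAux, Matrix.of_apply]
    rw [Finset.sum_eq_single (g n), Finset.sum_eq_single f]
    · simp
    · intro b _ hb
      simp [hb.symm]
    · simp
    · intro b _ hb
      simp [hb]
    · simp
  rw [h1, siteProd_apply, ← Finset.mul_prod_erase _ _ (Finset.mem_univ n), Pi.mulSingle_eq_same,
    Finset.sum_eq_single (f n)]
  · congr 1
    rw [Finset.prod_congr rfl (g := fun a => if f a = g a then (1 : ℂ) else 0),
      Finset.prod_ite_zero]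
    · simp [funext_iff, Function.update_apply]
      congr 1
      refine propext ⟨fun h a ha => by simpa [ha] using h a, fun h a => ?_⟩
      split_ifs with ha
      · rw [ha]
      · exact h a ha
    · intro a ha
      rw [Pi.mulSingle_eq_of_ne (Finset.ne_of_mem_erase ha), Matrix.one_apply]
  · intro v _ hv
    rw [if_neg, mul_zero]
    rintro rfl
    simp at hv
  · simp

/-- The transfer matrix at the `n`-th inhomogeneity, for inhomogeneities `a / ε`, with the powers
of `ε⁻¹` removed. -/
def scaledT1 (η : ℂ) (a : Fin N → ℂ) (K : Matrix (Fin 3) (Fin 3) ℂ) (n : Fin N) (ε : ℂ) : Op N :=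
  auxTrace (Kaux K * (List.ofFn fun m : Fin N =>
    if m = n then η • permAux m
    else (a n - a m) • (1 : Matrix (Fin 3 × St N) (Fin 3 × St N) ℂ)
      + (ε * η) • permAux m).reverse.prod)

lemma exists_T1_eq_smul_scaledT1 (η : ℂ) (a : Fin N → ℂ) (K : Matrix (Fin 3) (Fin 3) ℂ)
    (n : Fin N) {ε : ℂ} (hε : ε ≠ 0) :
    ∃ c : ℂ, c ≠ 0 ∧ T1 η (ε⁻¹ • a) K ((ε⁻¹ • a) n) = c • scaledT1 η a K n ε := by
  refine ⟨((List.finRange N).reverse.map fun m => if m = n then 1 else ε⁻¹).prod, ?_, ?_⟩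
  · refine List.prod_ne_zero ?_
    simp only [List.mem_map, not_exists, not_and]
    intro m _
    split_ifs <;> simp [hε]
  · rw [T1_eq, monodromy, scaledT1, ← map_smul, ← Matrix.mul_smul]
    simp only [List.ofFn_eq_map, ← List.map_reverse]
    rw [← list_prod_smul]
    congr 4
    funext m
    rw [Raux_eq]
    split_ifs with h
    · simp [h]
    · rw [smul_add, smul_smul, smul_smul, inv_mul_cancel_left₀ hε]
      simp [mul_sub]

lemma exists_scaledT1_zero {η : ℂ} (hη : η ≠ 0) {a : Fin N → ℂ} (ha : Function.Injective a)
    (K : Matrix (Fin 3) (Fin 3) ℂ) (n : Fin N) :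
    ∃ c : ℂ, c ≠ 0 ∧ scaledT1 η a K n 0 = c • siteProd (Pi.mulSingle n K) := by
  refine ⟨((List.finRange N).reverse.map fun m => if m = n then η else a n - a m).prod, ?_, ?_⟩
  · refine List.prod_ne_zero ?_
    simp only [List.mem_map, not_exists, not_and]
    intro m _
    split_ifs with h
    · exact hη
    · exact sub_ne_zero.2 fun h' => h (ha h').symm
  · rw [← auxTrace_Kaux_mul_permAux, scaledT1, ← map_smul, ← Matrix.mul_smul]
    have h := reverse_prod_ofFn_eq_single n
      (fun m => if m = n then permAux m else (1 : Matrix (Fin 3 × St N) (Fin 3 × St N) ℂ))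
      fun m hm => if_neg hm
    rw [if_pos rfl] at h
    rw [← h]
    simp only [List.ofFn_eq_map, ← List.map_reverse]
    rw [← list_prod_smul]
    congr 4
    funext m
    split_ifs <;> simp

lemma continuous_scaledT1 (η : ℂ) (a : Fin N → ℂ) (K : Matrix (Fin 3) (Fin 3) ℂ) (n : Fin N) :
    Continuous (scaledT1 η a K n) := by
  unfold scaledT1
  refine auxTrace.continuous_of_finiteDimensional.comp (continuous_const.mul ?_)
  simp only [List.ofFn_eq_map, ← List.map_reverse]
  refine continuous_list_prod _ fun m _ => ?_
  split_ifs <;> fun_prop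

/-- Rescaling the one-site factors does not affect the independence of the generated family. -/
lemma linearIndependent_smul_pow_iff (Φ : Op N →ₗ[ℂ] Hsp N) {A B : Fin N → Op N} {c : Fin N → ℂ}
    (hc : ∀ n, c n ≠ 0) (hAB : ∀ n, A n = c n • B n) :
    (LinearIndependent ℂ fun h : St N => Φ (List.ofFn fun n => A n ^ (h n : ℕ)).prod) ↔
      LinearIndependent ℂ fun h : St N => Φ (List.ofFn fun n => B n ^ (h n : ℕ)).prod := by
  have hw (h : St N) : ((List.finRange N).map fun n => c n ^ (h n : ℕ)).prod ≠ 0 := by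
    refine List.prod_ne_zero ?_
    simp only [List.mem_map, not_exists, not_and]
    exact fun n _ => pow_ne_zero _ (hc n)
  rw [← LinearIndependent.units_smul_iff (w := fun h => Units.mk0 _ (hw h))
    (v := fun h : St N => Φ (List.ofFn fun n => B n ^ (h n : ℕ)).prod)]
  have : (fun h : St N => Φ (List.ofFn fun n => A n ^ (h n : ℕ)).prod) =
      (fun h => Units.mk0 _ (hw h)) •
        fun h : St N => Φ (List.ofFn fun n => B n ^ (h n : ℕ)).prod := by
    funext h
    simp only [Pi.smul_apply', Units.smul_def, Units.val_mk0, ← map_smul, List.ofFn_eq_map,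
      hAB, smul_pow, list_prod_smul]
  rw [this]

lemma exists_linearIndependent_T1_prod {η : ℂ} (hη : η ≠ 0) (K : Matrix (Fin 3) (Fin 3) ℂ)
    (Φ : Op N →ₗ[ℂ] Hsp N)
    (hΦ : LinearIndependent ℂ fun h : St N => Φ (siteProd fun n => K ^ (h n : ℕ))) :
    ∃ ξ : Fin N → ℂ, LinearIndependent ℂ fun h : St N =>
      Φ (List.ofFn fun n => T1 η ξ K (ξ n) ^ (h n : ℕ)).prod := by
  let a : Fin N → ℂ := fun n => ((n : ℕ) : ℂ)
  have ha : Function.Injective a := fun m n h => Fin.ext (Nat.cast_injective h)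
  have hcont : Continuous fun ε => (Matrix.of fun h : St N =>
      Φ (List.ofFn fun n => scaledT1 η a K n ε ^ (h n : ℕ)).prod).det := by
    refine Continuous.matrix_det (continuous_pi fun h => ?_)
    refine Φ.continuous_of_finiteDimensional.comp ?_
    simp only [List.ofFn_eq_map]
    exact continuous_list_prod _ fun n _ => (continuous_scaledT1 η a K n).pow _
  have hzero : (Matrix.of fun h : St N =>
      Φ (List.ofFn fun n => scaledT1 η a K n 0 ^ (h n : ℕ)).prod).det ≠ 0 := by
    rw [← linearIndependent_iff_det_ne_zero]
    choose c hc hc' using exists_scaledT1_zero hη ha K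
    rw [linearIndependent_smul_pow_iff Φ hc hc']
    convert hΦ using 3 with h
    simp_rw [← map_pow, ← Pi.mulSingle_pow]
    conv_rhs => rw [← prod_ofFn_mulSingle fun n => K ^ (h n : ℕ), map_list_prod, List.map_ofFn]
    rfl
  have hev := hcont.continuousAt.eventually_ne hzero
  obtain ⟨ε, hdet, hε⟩ :=
    ((hev.filter_mono nhdsWithin_le_nhds).and (self_mem_nhdsWithin (s := {(0 : ℂ)}ᶜ))).exists
  choose c hc hc' using fun n => exists_T1_eq_smul_scaledT1 η a K n hε
  refine ⟨ε⁻¹ • a, ?_⟩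
  rwa [linearIndependent_smul_pow_iff Φ hc hc', linearIndependent_iff_det_ne_zero]

lemma exists_det_powCov_ne_zero {η : ℂ} (hη : η ≠ 0) {K : Matrix (Fin 3) (Fin 3) ℂ}
    {v : Fin 3 → ℂ} (hv : (Matrix.of fun i : Fin 3 => Matrix.vecMul v (K ^ (i : ℕ))).det ≠ 0) :
    ∃ ξ : Fin N → ℂ, (Matrix.of (powCov η ξ K fun f => ∏ a, v (f a))).det ≠ 0 := by
  simp_rw [← linearIndependent_iff_det_ne_zero]
  refine exists_linearIndependent_T1_prod hη K 
    (Matrix.vecMulBilin ℂ ℂ fun f : St N => ∏ a, v (f a)) ?_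
  convert linearIndependent_tensor (N := N) hv using 3 with h f
  exact vecMul_siteProd _ _ _

lemma exists_det_powVec_ne_zero {η : ℂ} (hη : η ≠ 0) {K : Matrix (Fin 3) (Fin 3) ℂ}
    {v : Fin 3 → ℂ} (hv : (Matrix.of fun i : Fin 3 => Matrix.mulVec (K ^ (i : ℕ)) v).det ≠ 0) :
    ∃ ξ : Fin N → ℂ, (Matrix.of (powVec η ξ K fun f => ∏ a, v (f a))).det ≠ 0 := by
  simp_rw [← linearIndependent_iff_det_ne_zero]
  refine exists_linearIndependent_T1_prod hη K
    ((Matrix.mulVecBilin ℂ ℂ).flip fun f : St N => ∏ a, v (f a)) ?_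
  convert linearIndependent_tensor (N := N) hv using 3 with h f
  exact siteProd_mulVec _ _ _

/-! ### Cyclic vectors -/

lemma exists_det_mulVec_ne_zero {A : Matrix (Fin 3) (Fin 3) ℂ}
    (hA : ∀ q : Polynomial ℂ, q.degree < 3 → Polynomial.aeval A q = 0 → q = 0) :
    ∃ v : Fin 3 → ℂ, (Matrix.of fun i : Fin 3 => Matrix.mulVec (A ^ (i : ℕ)) v).det ≠ 0 := by
  classical
  have hdeg : A.charpoly.degree = 3 := by simp [A.charpoly_degree_eq_dim]
  have hmonic := A.charpoly_monic
  let ker : ℂ → Submodule ℂ (Fin 3 → ℂ) := fun μ => LinearMap.ker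
    (Polynomial.aeval A (A.charpoly /ₘ (Polynomial.X - Polynomial.C μ))).mulVecLin
  have hker : ⊤ ∉ A.charpoly.roots.toFinset.image ker := by
    simp only [Finset.mem_image, Multiset.mem_toFinset, not_exists, not_and]
    intro μ hμ htop
    have hzero : Polynomial.aeval A (A.charpoly /ₘ (Polynomial.X - Polynomial.C μ)) = 0 := by
      rw [LinearMap.ker_eq_top] at htop
      exact Matrix.ext_of_mulVec_single fun i => by
        rw [Matrix.zero_mulVec]
        exact LinearMap.congr_fun htop (Pi.single i 1)
    have hlt : (A.charpoly /ₘ (Polynomial.X - Polynomial.C μ)).degree < 3 := by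
      rw [← hdeg]
      exact Polynomial.degree_divByMonic_lt _ _ hmonic.ne_zero (by simp)
    have h := Polynomial.mul_divByMonic_eq_iff_isRoot.2 (Polynomial.isRoot_of_mem_roots hμ)
    rw [hA _ hlt hzero, mul_zero] at h
    exact hmonic.ne_zero h.symm
  obtain ⟨v, hv⟩ := (Set.ne_univ_iff_exists_notMem _).1
    (Subspace.biUnion_ne_univ_of_top_notMem hker)
  refine ⟨v, ?_⟩
  rw [← linearIndependent_iff_det_ne_zero, Fintype.linearIndependent_iff]
  intro c hc
  let q : Polynomial ℂ := Polynomial.ofFn 3 c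
  have hqv : (Polynomial.aeval A q).mulVec v = 0 := by
    rw [← hc]
    simp [q, Polynomial.ofFn_eq_sum_monomial, Fin.sum_univ_three, Polynomial.aeval_monomial,
      Matrix.add_mulVec, Algebra.algebraMap_eq_smul_one, Matrix.smul_mulVec]
  have hq : q = 0 := by
    by_contra hq
    obtain ⟨u, w, huw⟩ : ∃ u w, EuclideanDomain.gcd q A.charpoly = q * u + A.charpoly * w :=
      ⟨_, _, EuclideanDomain.gcd_eq_gcd_ab _ _⟩
    obtain ⟨s, hs⟩ := EuclideanDomain.gcd_dvd_right q A.charpoly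
    set g := EuclideanDomain.gcd q A.charpoly
    have hgv : (Polynomial.aeval A g).mulVec v = 0 := by
      rw [huw, mul_comm q]
      simp [Matrix.aeval_self_charpoly, ← Matrix.mulVec_mulVec, hqv]
    have hgdeg : g.degree < 3 :=
      (Polynomial.degree_le_of_dvd (EuclideanDomain.gcd_dvd_left q _) hq).trans_lt
        (Polynomial.ofFn_degree_lt c)
    have hsdeg : s.degree ≠ 0 := by
      intro h0
      have := congrArg Polynomial.degree hs
      rw [Polynomial.degree_mul, h0, add_zero, hdeg] at this
      exact hgdeg.ne this.symm
    obtain ⟨μ, hμ⟩ := IsAlgClosed.exists_root s hsdeg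
    obtain ⟨s', hs'⟩ := Polynomial.dvd_iff_isRoot.2 hμ
    apply hv
    have hroot : μ ∈ A.charpoly.roots := by
      rw [Polynomial.mem_roots hmonic.ne_zero, hs]
      simp [hμ.eq_zero]
    refine Set.mem_biUnion (x := ker μ) ?_ ?_
    · simpa using ⟨μ, by simpa using hroot, rfl⟩
    have : A.charpoly /ₘ (Polynomial.X - Polynomial.C μ) = s' * g := by
      rw [hs, hs', mul_left_comm,
        Polynomial.mul_divByMonic_cancel_left _ (Polynomial.monic_X_sub_C μ), mul_comm]
    simp [ker, this, hgv]
  intro i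
  have := congrArg (fun p => Polynomial.coeff p i) hq
  simpa [q] using this

lemma eq_zero_of_aeval_eq_zero {K : Matrix (Fin 3) (Fin 3) ℂ} (hK : SimpleSpectrum K)
    (q : Polynomial ℂ) (hq : q.degree < 3) (h : Polynomial.aeval K q = 0) : q = 0 := by
  by_contra hne
  have := minpoly.degree_le_of_ne_zero ℂ K hne h
  rw [hK, K.charpoly_degree_eq_dim] at this
  exact absurd hq (not_lt.2 (by simpa using this))

lemma exists_det_vecMul_ne_zero {A : Matrix (Fin 3) (Fin 3) ℂ}
    (hA : ∀ q : Polynomial ℂ, q.degree < 3 → Polynomial.aeval A q = 0 → q = 0) :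
    ∃ v : Fin 3 → ℂ, (Matrix.of fun i : Fin 3 => Matrix.vecMul v (A ^ (i : ℕ))).det ≠ 0 := by
  have h := exists_det_mulVec_ne_zero (A := A.transpose) fun q hq h => hA q hq <| by
    rw [← Matrix.transpose_eq_zero, ← h, Polynomial.aeval_eq_sum_range,
      Polynomial.aeval_eq_sum_range]
    simp [Matrix.transpose_sum, Matrix.transpose_pow]
  simpa only [← Matrix.transpose_pow, Matrix.mulVec_transpose] using h

lemma det_vecMul_KJmat_ne_zero {k₀ k₁ k₂ y₁ y₂ x y z : ℂ}
    (h : (k₀ ≠ k₁ ∧ k₀ ≠ k₂ ∧ k₁ ≠ k₂ ∧ y₁ = 0 ∧ y₂ = 0 ∧ x * y * z ≠ 0) ∨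
       (k₀ = k₁ ∧ k₀ ≠ k₂ ∧ y₁ = 1 ∧ y₂ = 0 ∧ x * z ≠ 0) ∨
       (k₀ = k₁ ∧ k₁ = k₂ ∧ y₁ = 1 ∧ y₂ = 1 ∧ x ≠ 0)) :
    (Matrix.of fun i : Fin 3 =>
      Matrix.vecMul ![x, y, z] (KJmat k₀ k₁ k₂ y₁ y₂ ^ (i : ℕ))).det ≠ 0 := by
  rcases h with ⟨h₀₁, h₀₂, h₁₂, rfl, rfl, hx⟩ | ⟨rfl, h₀₂, rfl, rfl, hx⟩ | ⟨rfl, rfl, rfl, rfl, hx⟩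
  · have hne : x * y * z * ((k₁ - k₀) * (k₂ - k₀) * (k₂ - k₁)) ≠ 0 := by
      simp [sub_eq_zero, h₀₁.symm, h₀₂.symm, h₁₂.symm, mul_ne_zero_iff.1 hx]
    convert hne using 1
    simp [Matrix.det_fin_three, KJmat, pow_two, Matrix.vecMul, dotProduct, Fin.sum_univ_three,
      Matrix.mul_apply]
    ring
  · have hne : x * (x * z) * (k₂ - k₀) ^ 2 ≠ 0 := by
      simp [sub_eq_zero, h₀₂.symm, mul_ne_zero_iff.1 hx]
    convert hne using 1
    simp [Matrix.det_fin_three, KJmat, pow_two, Matrix.vecMul, dotProduct, Fin.sum_univ_three,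
      Matrix.mul_apply]
    ring
  · convert pow_ne_zero 3 hx using 1
    simp [Matrix.det_fin_three, KJmat, pow_two, Matrix.vecMul, dotProduct, Fin.sum_univ_three,
      Matrix.mul_apply]
    ring

lemma det_KJmat_mulVec_ne_zero {k₀ k₁ k₂ y₁ y₂ r s t : ℂ}
    (h : (k₀ ≠ k₁ ∧ k₀ ≠ k₂ ∧ k₁ ≠ k₂ ∧ y₁ = 0 ∧ y₂ = 0 ∧ r * s * t ≠ 0) ∨
       (k₀ = k₁ ∧ k₀ ≠ k₂ ∧ y₁ = 1 ∧ y₂ = 0 ∧ s * t ≠ 0) ∨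
       (k₀ = k₁ ∧ k₁ = k₂ ∧ y₁ = 1 ∧ y₂ = 1 ∧ t ≠ 0)) :
    (Matrix.of fun i : Fin 3 =>
      Matrix.mulVec (KJmat k₀ k₁ k₂ y₁ y₂ ^ (i : ℕ)) ![r, s, t]).det ≠ 0 := by
  rcases h with ⟨h₀₁, h₀₂, h₁₂, rfl, rfl, hr⟩ | ⟨rfl, h₀₂, rfl, rfl, hs⟩ | ⟨rfl, rfl, rfl, rfl, ht⟩
  · have hne : r * s * t * ((k₁ - k₀) * (k₂ - k₀) * (k₂ - k₁)) ≠ 0 := by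
      simp [sub_eq_zero, h₀₁.symm, h₀₂.symm, h₁₂.symm, mul_ne_zero_iff.1 hr]
    convert hne using 1
    simp [Matrix.det_fin_three, KJmat, pow_two, Matrix.mulVec, dotProduct, Fin.sum_univ_three,
      Matrix.mul_apply]
    ring
  · have hne : -(s * (s * t) * (k₂ - k₀) ^ 2) ≠ 0 := by
      simp [sub_eq_zero, h₀₂.symm, mul_ne_zero_iff.1 hs]
    convert hne using 1
    simp [Matrix.det_fin_three, KJmat, pow_two, Matrix.mulVec, dotProduct, Fin.sum_univ_three,
      Matrix.mul_apply]
    ring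
  · convert neg_ne_zero.2 (pow_ne_zero 3 ht) using 1
    simp [Matrix.det_fin_three, KJmat, pow_two, Matrix.mulVec, dotProduct, Fin.sum_univ_three,
      Matrix.mul_apply]
    ring

lemma conj_pow {W J : Matrix (Fin 3) (Fin 3) ℂ} (hW : IsUnit W.det) (i : ℕ) :
    (W * J * W⁻¹) ^ i = W * J ^ i * W⁻¹ := by
  induction i with
  | zero => simp [Matrix.mul_nonsing_inv W hW]
  | succ i ih =>
    rw [pow_succ, ih, pow_succ]
    simp only [Matrix.mul_assoc, Matrix.nonsing_inv_mul_cancel_left W _ hW]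

lemma det_vecMul_conj_ne_zero {W J : Matrix (Fin 3) (Fin 3) ℂ} (hW : IsUnit W.det)
    {v : Fin 3 → ℂ} (h : (Matrix.of fun i : Fin 3 => Matrix.vecMul v (J ^ (i : ℕ))).det ≠ 0) :
    (Matrix.of fun i : Fin 3 =>
      Matrix.vecMul (Matrix.vecMul v W⁻¹) ((W * J * W⁻¹) ^ (i : ℕ))).det ≠ 0 := by
  have hinv : W⁻¹.det ≠ 0 := (Matrix.isUnit_nonsing_inv_det W hW).ne_zero
  convert mul_ne_zero h hinv using 1
  rw [← Matrix.det_mul]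
  congr 1
  ext i j
  rw [Matrix.of_apply, conj_pow hW, Matrix.vecMul_vecMul, Matrix.mul_assoc,
    Matrix.nonsing_inv_mul_cancel_left W _ hW, ← Matrix.vecMul_vecMul]
  rfl

lemma det_conj_mulVec_ne_zero {W J : Matrix (Fin 3) (Fin 3) ℂ} (hW : IsUnit W.det)
    {v : Fin 3 → ℂ} (h : (Matrix.of fun i : Fin 3 => Matrix.mulVec (J ^ (i : ℕ)) v).det ≠ 0) :
    (Matrix.of fun i : Fin 3 =>
      Matrix.mulVec ((W * J * W⁻¹) ^ (i : ℕ)) (Matrix.mulVec W v)).det ≠ 0 := by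
  have hdet : W.transpose.det ≠ 0 := by simpa using hW.ne_zero
  convert mul_ne_zero h hdet using 1
  rw [← Matrix.det_mul]
  congr 1
  ext i j
  rw [Matrix.of_apply, conj_pow hW, Matrix.mulVec_mulVec, Matrix.mul_assoc,
    Matrix.nonsing_inv_mul W hW, Matrix.mul_one, ← Matrix.mulVec_mulVec, ← Matrix.vecMul_transpose]
  rfl

/-- for a simple-spectrum twist `K`, for all choices of `⟨L|`, `|R⟩` and of the
inhomogeneities outside a proper algebraic subset, the `3^N` co-vectors
`⟨L|∏_n T₁^{(K)}(ξ_n)^{h_n}` form a basis of `H^*` and the `3^N` vectors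
`∏_n T₁^{(K)}(ξ_n)^{h_n}|R⟩` form a basis of `H`; in particular the tensor product forms
with the case-wise admissibility conditions may be taken. -/
theorem statement_0 (N : ℕ) (hN : 1 ≤ N) (η : ℂ) (hη : η ≠ 0)
    (K : Matrix (Fin 3) (Fin 3) ℂ) (hK : SimpleSpectrum K) :
    (∃ P : MvPolynomial ((St N ⊕ St N) ⊕ Fin N) ℂ, P ≠ 0 ∧
      ∀ (L R : Hsp N) (ξ : Fin N → ℂ), InhomCond η ξ →
        MvPolynomial.eval (Sum.elim (Sum.elim L R) ξ) P ≠ 0 →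
        IsBasisFamily (powCov η ξ K L) ∧ IsBasisFamily (powVec η ξ K R)) ∧
    (∀ (W : Matrix (Fin 3) (Fin 3) ℂ) (k₀ k₁ k₂ y₁ y₂ x y z r s t : ℂ),
      JordanData K W k₀ k₁ k₂ y₁ y₂ →
      ((k₀ ≠ k₁ ∧ k₀ ≠ k₂ ∧ k₁ ≠ k₂ ∧ y₁ = 0 ∧ y₂ = 0 ∧ x * y * z ≠ 0 ∧ r * s * t ≠ 0) ∨
       (k₀ = k₁ ∧ k₀ ≠ k₂ ∧ y₁ = 1 ∧ y₂ = 0 ∧ x * z ≠ 0 ∧ s * t ≠ 0) ∨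
       (k₀ = k₁ ∧ k₁ = k₂ ∧ y₁ = 1 ∧ y₂ = 1 ∧ x ≠ 0 ∧ t ≠ 0)) →
      ∃ Q : MvPolynomial (Fin N) ℂ, Q ≠ 0 ∧
        ∀ ξ : Fin N → ℂ, InhomCond η ξ → MvPolynomial.eval ξ Q ≠ 0 →
          IsBasisFamily (powCov η ξ K (tensorCov W x y z)) ∧
          IsBasisFamily (powVec η ξ K (tensorVec W r s t))) := by
  constructor
  · obtain ⟨v, hv⟩ := exists_det_vecMul_ne_zero (eq_zero_of_aeval_eq_zero hK)
    obtain ⟨u, hu⟩ := exists_det_mulVec_ne_zero (eq_zero_of_aeval_eq_zero hK)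
    obtain ⟨ξ₁, hξ₁⟩ := exists_det_powCov_ne_zero (N := N) hη hv
    obtain ⟨ξ₂, hξ₂⟩ := exists_det_powVec_ne_zero (N := N) hη hu
    obtain ⟨p, hp⟩ := isPoly_det_powCov (N := N) (σ := (St N ⊕ St N) ⊕ Fin N) η K
      (ξ := fun X n => X (.inr n)) (fun n => .coord _)
      (L := fun X f => X (.inl (.inl f))) fun f => .coord _
    obtain ⟨q, hq⟩ := isPoly_det_powVec (N := N) (σ := (St N ⊕ St N) ⊕ Fin N) η K
      (ξ := fun X n => X (.inr n)) (fun n => .coord _)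
      (R := fun X f => X (.inl (.inr f))) fun f => .coord _
    refine ⟨p * q, mul_ne_zero ?_ ?_, fun L R ξ _ h => ?_⟩
    · rintro rfl
      exact hξ₁ (hp (Sum.elim (Sum.elim (fun f => ∏ a, v (f a)) 0) ξ₁)).symm
    · rintro rfl
      exact hξ₂ (hq (Sum.elim (Sum.elim 0 fun f => ∏ a, u (f a)) ξ₂)).symm
    · rw [map_mul, hp, hq] at h
      exact ⟨isBasisFamily_of_det_ne_zero (left_ne_zero_of_mul h),
        isBasisFamily_of_det_ne_zero (right_ne_zero_of_mul h)⟩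
  · rintro W k₀ k₁ k₂ y₁ y₂ x y z r s t ⟨hW, rfl⟩ h
    obtain ⟨ξ₁, hξ₁⟩ := exists_det_powCov_ne_zero (N := N) hη <| det_vecMul_conj_ne_zero hW <|
      det_vecMul_KJmat_ne_zero (k₀ := k₀) (k₁ := k₁) (k₂ := k₂) (y₁ := y₁) (y₂ := y₂)
        (x := x) (y := y) (z := z) <|
      h.imp (fun ⟨a, b, c, d, e, f, _⟩ => ⟨a, b, c, d, e, f⟩) <|
        Or.imp (fun ⟨a, b, c, d, e, _⟩ => ⟨a, b, c, d, e⟩) fun ⟨a, b, c, d, e, _⟩ => ⟨a, b, c, d, e⟩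
    obtain ⟨ξ₂, hξ₂⟩ := exists_det_powVec_ne_zero (N := N) hη <| det_conj_mulVec_ne_zero hW <|
      det_KJmat_mulVec_ne_zero (k₀ := k₀) (k₁ := k₁) (k₂ := k₂) (y₁ := y₁) (y₂ := y₂)
        (r := r) (s := s) (t := t) <|
      h.imp (fun ⟨a, b, c, d, e, _, f⟩ => ⟨a, b, c, d, e, f⟩) <|
        Or.imp (fun ⟨a, b, c, d, _, e⟩ => ⟨a, b, c, d, e⟩) fun ⟨a, b, c, d, _, e⟩ => ⟨a, b, c, d, e⟩
    obtain ⟨p, hp⟩ := isPoly_det_powCov (N := N) (σ := Fin N) η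
      (W * KJmat k₀ k₁ k₂ y₁ y₂ * W⁻¹) (ξ := fun X => X) (fun n => .coord n)
      (L := fun _ => tensorCov W x y z) fun f => .const _
    obtain ⟨q, hq⟩ := isPoly_det_powVec (N := N) (σ := Fin N) η
      (W * KJmat k₀ k₁ k₂ y₁ y₂ * W⁻¹) (ξ := fun X => X) (fun n => .coord n)
      (R := fun _ => tensorVec W r s t) fun f => .const _
    refine ⟨p * q, mul_ne_zero ?_ ?_, fun ξ _ h => ?_⟩
    · rintro rfl
      exact hξ₁ (hp ξ₁).symm
    · rintro rfl
      exact hξ₂ (hq ξ₂).symm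
    · rw [map_mul, hp, hq] at h
      exact ⟨isBasisFamily_of_det_ne_zero (left_ne_zero_of_mul h),
        isBasisFamily_of_det_ne_zero (right_ne_zero_of_mul h)⟩

end
end SoV
end

section
/- Let K be a 3×3 complex matrix with simple spectrum, and assume the SoV covectors ⟨h| and SoV vectors |h⟩ form bases (generic parameters). Then for every h ∈ {0,1,2}^N the diagonal coupling equals N_h := ⟨h|h⟩ = ( ∏_{a=1}^N d(ξ_a^{(1)}) / d(ξ_a^{(1+δ_{h_a,1}+δ_{h_a,2})}) ) · V(ξ₁,…,ξ_N)² / ( V(ξ₁^{(δ_{h₁,1}+δ_{h₁,2})},…,ξ_N^{(δ_{h_N,1}+δ_{h_N,2})}) · V(ξ₁^{(δ_{h₁,2})},…,ξ_N^{(δ_{h_N,2})}) ). -/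
open scoped BigOperators

namespace SoV
noncomputable section

open Finset

/-- Value at `x` of the Lagrange polynomial attached to the node `p m`. -/
noncomputable def lagr {ι : Type*} [Fintype ι] [DecidableEq ι] (p : ι → ℂ) (x : ℂ) (m : ι) : ℂ :=
  ∏ j ∈ univ.erase m, (x - p j) / (p m - p j)

theorem lagr_eq_eval_basis {ι : Type*} [Fintype ι] [DecidableEq ι] (p : ι → ℂ) (x : ℂ) (m : ι) :
    lagr p x m = (Lagrange.basis univ p m).eval x := by
  simp only [lagr, Lagrange.basis, Lagrange.basisDivisor, Polynomial.eval_prod]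
  refine prod_congr rfl fun j _ => ?_
  simp [div_eq_inv_mul]

theorem eval_eq_sum_lagr {ι : Type*} [Fintype ι] [DecidableEq ι] {p : ι → ℂ}
    (hp : Function.Injective p) {f : Polynomial ℂ} (hf : f.degree < Fintype.card ι) (x : ℂ) :
    f.eval x = ∑ m, lagr p x m * f.eval (p m) := by
  have h := Lagrange.eq_interpolate (s := univ) (v := p) (f := f) hp.injOn (by simpa using hf)
  conv_lhs => rw [h]
  simp [Lagrange.interpolate_apply, Polynomial.eval_finsetSum, lagr_eq_eval_basis, mul_comm]

theorem pow_eq_sum_lagr {ι : Type*} [Fintype ι] [DecidableEq ι] {p : ι → ℂ}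
    (hp : Function.Injective p) {i : ℕ} (hi : i < Fintype.card ι) (x : ℂ) :
    x ^ i = ∑ m, lagr p x m * p m ^ i := by
  simpa using eval_eq_sum_lagr hp (f := Polynomial.X ^ i)
    (by rw [Polynomial.degree_X_pow]; exact_mod_cast hi) x

theorem pow_card_eq_sum_lagr {ι : Type*} [Fintype ι] [DecidableEq ι] {p : ι → ℂ}
    (hp : Function.Injective p) (x : ℂ) :
    x ^ Fintype.card ι = ∏ m, (x - p m) + ∑ m, lagr p x m * p m ^ Fintype.card ι := by
  have hm : (∏ m, (Polynomial.X - Polynomial.C (p m)) : Polynomial ℂ).Monic :=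
    Polynomial.monic_prod_of_monic _ _ fun m _ => Polynomial.monic_X_sub_C _
  have hd : (∏ m, (Polynomial.X - Polynomial.C (p m)) : Polynomial ℂ).degree = Fintype.card ι := by
    rw [Polynomial.degree_prod]; simp
  have h := eval_eq_sum_lagr hp
    (f := Polynomial.X ^ Fintype.card ι - ∏ m, (Polynomial.X - Polynomial.C (p m))) (by
      have := Polynomial.degree_sub_lt_left (p := (Polynomial.X ^ Fintype.card ι : Polynomial ℂ))
        (q := ∏ m, (Polynomial.X - Polynomial.C (p m))) (by rw [hd, Polynomial.degree_X_pow])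
        (pow_ne_zero _ Polynomial.X_ne_zero) (by rw [hm.leadingCoeff]; simp)
      rwa [Polynomial.degree_X_pow] at this) x
  have h0 : ∀ m, ∏ j, (p m - p j) = 0 := fun m => prod_eq_zero (mem_univ m) (sub_self _)
  simp only [Polynomial.eval_sub, Polynomial.eval_pow, Polynomial.eval_X, Polynomial.eval_prod,
    Polynomial.eval_C, h0, sub_zero] at h
  rw [← h]; ring

/-- `F` is a polynomial function of degree at most `n` whose coefficient of degree `n` is `c`. -/
def IsPolyWithLead {V : Type*} [AddCommGroup V] [Module ℂ V] (n : ℕ) (c : V) (F : ℂ → V) : Prop :=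
  ∃ a : ℕ → V, ∀ x, F x = x ^ n • c + ∑ i ∈ range n, x ^ i • a i

theorem IsPolyWithLead.interpolation {V : Type*} [AddCommGroup V] [Module ℂ V]
    {ι : Type*} [Fintype ι] [DecidableEq ι] {c : V} {F : ℂ → V}
    (hF : IsPolyWithLead (Fintype.card ι) c F) {p : ι → ℂ} (hp : Function.Injective p) (x : ℂ) :
    F x = (∏ m, (x - p m)) • c + ∑ m, lagr p x m • F (p m) := by
  obtain ⟨a, ha⟩ := hF
  simp only [ha, smul_add, sum_add_distrib, smul_sum, smul_smul]
  rw [← sum_smul, ← add_assoc, ← add_smul, ← pow_card_eq_sum_lagr hp, sum_comm]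
  congr 1
  refine sum_congr rfl fun i hi => ?_
  rw [← sum_smul, ← pow_eq_sum_lagr hp (mem_range.1 hi)]

theorem IsPolyWithLead.map {V W : Type*} [AddCommGroup V] [Module ℂ V] [AddCommGroup W]
    [Module ℂ W] {n : ℕ} {c : V} {F : ℂ → V} (hF : IsPolyWithLead n c F) (f : V →ₗ[ℂ] W) :
    IsPolyWithLead n (f c) fun x => f (F x) := by
  obtain ⟨a, ha⟩ := hF
  exact ⟨fun i => f (a i), fun x => by simp [ha]⟩

theorem isPolyWithLead_list_prod {R : Type*} [Ring R] [Algebra ℂ R] (l : List R) :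
    IsPolyWithLead l.length 1 fun x : ℂ => (l.map fun b => x • (1 : R) + b).prod := by
  induction l with
  | nil => exact ⟨0, by simp⟩
  | cons b l ih =>
    obtain ⟨a, ha⟩ := ih
    refine ⟨fun i => (if i = 0 then 0 else a (i - 1)) + b * (if i = l.length then 1 else a i),
      fun x => ?_⟩
    simp only [List.map_cons, List.prod_cons, ha, List.length_cons, smul_add, sum_add_distrib]
    rw [sum_range_succ', sum_range_succ (fun i => x ^ i • (b * _))]
    have : ∀ i ∈ range l.length, x ^ i • (b * (if i = l.length then 1 else a i)) =
        x ^ i • (b * a i) := fun i hi => by rw [if_neg (mem_range.1 hi).ne]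
    rw [sum_congr rfl this]
    simp [add_mul, mul_add, mul_sum, smul_smul, pow_succ, mul_comm, sum_add_distrib]
    abel

variable {N : ℕ}

/-- Commuting operators `T`, `t` obeying the functional relations satisfied by the transfer
matrix `T₁` and by the reduced fused transfer matrix `T₂(λ) / d(λ - η)`. -/
structure FusionSystem {A : Type*} [CommRing A] [Algebra ℂ A] (η : ℂ) (ξ : Fin N → ℂ)
    (T t : ℂ → A) : Prop where
  poly_T : ∃ c : ℂ, IsPolyWithLead N (algebraMap ℂ A c) T
  poly_t : ∃ c : ℂ, IsPolyWithLead N (algebraMap ℂ A c) t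
  fusion : ∀ n, T (ξ n) * T (ξ n - η) = dfun ξ (ξ n - η) • t (ξ n)
  qdet : ∀ n, ∃ q : ℂ, T (ξ n) * t (ξ n - η) = algebraMap ℂ A q

theorem dfun_sub_ne_zero {η : ℂ} (hη : η ≠ 0) {ξ : Fin N → ℂ} (hξ : InhomCond η ξ) (n : Fin N) :
    dfun ξ (ξ n - η) ≠ 0 := by
  refine prod_ne_zero_iff.2 fun m _ h => ?_
  by_cases hnm : n = m
  · subst hnm; apply hη; linear_combination -h
  · exact (hξ n m hnm).2.1 (by linear_combination h)

theorem injective_sub_mul {η : ℂ} {ξ : Fin N → ℂ} (hξ : InhomCond η ξ) (P : Fin N → Prop)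
    [DecidablePred P] : Function.Injective fun m => ξ m - (if P m then 0 else 1) * η := by
  intro i j hij
  by_contra hne
  obtain ⟨h0, h1, h2⟩ := hξ i j hne
  dsimp only at hij
  split_ifs at hij
  · exact h0 (by linear_combination hij)
  · exact h2 (by linear_combination hij)
  · exact h1 (by linear_combination hij)
  · exact h0 (by linear_combination hij)

section FusionSystem

variable {A : Type*} [CommRing A] [Algebra ℂ A] (η : ℂ) (ξ : Fin N → ℂ) (T t : ℂ → A)

/-- Degree of the factor attached to a site label in the SoV co-vectors. -/
def labelDeg : Fin 3 → ℕ := ![2, 0, 1]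

/-- Factor of the SoV co-vector monomials at one site. -/
def covSite (n : Fin N) : Fin 3 → A := ![t (ξ n - η), 1, T (ξ n)]

/-- Monomials generating the SoV co-vectors. -/
def covMon (k : St N) : A := ∏ n, covSite η ξ T t n (k n)

/-- Degree filtration spanned by the SoV co-vector monomials. -/
def filt (D : ℕ) : Submodule ℂ A :=
  Submodule.span ℂ {y | ∃ k : St N, ∑ n, labelDeg (k n) ≤ D ∧ y = covMon η ξ T t k}

/-- Elements which raise the degree filtration by at most `D`. -/
def mulFilt (D : ℕ) : Submodule ℂ A where
  carrier := {y | ∀ E x, x ∈ filt η ξ T t E → y * x ∈ filt η ξ T t (E + D)}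
  add_mem' ha hb E x hx := by rw [add_mul]; exact add_mem (ha E x hx) (hb E x hx)
  zero_mem' E x _ := by rw [zero_mul]; exact zero_mem _
  smul_mem' c y hy E x hx := by
    rw [smul_mul_assoc]; exact Submodule.smul_mem _ _ (hy E x hx)

/-- The product of all factors of a co-vector monomial except the one at site `m`. -/
def covRest (k : St N) (m : Fin N) : A := ∏ n ∈ univ.erase m, covSite η ξ T t n (k n)

variable {η ξ T t}

omit [Algebra ℂ A] in
theorem covMon_eq (k : St N) (m : Fin N) :
    covMon η ξ T t k = covSite η ξ T t m (k m) * covRest η ξ T t k m :=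
  (mul_prod_erase univ (fun n => covSite η ξ T t n (k n)) (mem_univ m)).symm

omit [Algebra ℂ A] in
theorem covMon_update (k : St N) (m : Fin N) (i : Fin 3) :
    covMon η ξ T t (Function.update k m i) = covSite η ξ T t m i * covRest η ξ T t k m := by
  rw [covMon_eq _ m, Function.update_self]
  congr 1
  refine prod_congr rfl fun n hn => ?_
  rw [Function.update_of_ne (ne_of_mem_erase hn)]

theorem sum_labelDeg_update (k : St N) (m : Fin N) (i : Fin 3) :
    ∑ n, labelDeg (Function.update k m i n) + labelDeg (k m) =
      ∑ n, labelDeg (k n) + labelDeg i := by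
  rw [← add_sum_erase _ _ (mem_univ m), ← add_sum_erase _ (fun n => labelDeg (k n)) (mem_univ m),
    Function.update_self, sum_congr rfl fun n hn => by
      rw [Function.update_of_ne (ne_of_mem_erase hn)]]
  omega

theorem filt_mono {D E : ℕ} (h : D ≤ E) : filt η ξ T t D ≤ filt η ξ T t E :=
  Submodule.span_mono fun _ ⟨k, hk, hy⟩ => ⟨k, hk.trans h, hy⟩

theorem covMon_mem_filt {k : St N} {D : ℕ} (h : ∑ n, labelDeg (k n) ≤ D) :
    covMon η ξ T t k ∈ filt η ξ T t D := Submodule.subset_span ⟨k, h, rfl⟩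

theorem covMon_update_mem_filt {k : St N} {D E : ℕ} (h : ∑ n, labelDeg (k n) ≤ D) (m : Fin N)
    (i : Fin 3) (hE : D + labelDeg i ≤ E + labelDeg (k m)) :
    covSite η ξ T t m i * covRest η ξ T t k m ∈ filt η ξ T t E := by
  rw [← covMon_update]
  exact covMon_mem_filt (by have := sum_labelDeg_update k m i; omega)

theorem filt_le_comap {S : Submodule ℂ A} {D : ℕ} {y : A}
    (h : ∀ k : St N, ∑ n, labelDeg (k n) ≤ D → y * covMon η ξ T t k ∈ S) {x : A}
    (hx : x ∈ filt η ξ T t D) : y * x ∈ S := by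
  induction hx using Submodule.span_induction with
  | mem x hx => obtain ⟨k, hk, rfl⟩ := hx; exact h k hk
  | zero => rw [mul_zero]; exact zero_mem _
  | add x y _ _ hx hy => rw [mul_add]; exact add_mem hx hy
  | smul c x _ hx => rw [mul_smul_comm]; exact Submodule.smul_mem _ _ hx

/-- If multiplication by the values of `F` at `N` nodes maps `y` into `S`, then so does
multiplication by any value of `F`. -/
theorem IsPolyWithLead.mul_mem {F : ℂ → A} {c : ℂ} (hF : IsPolyWithLead N (algebraMap ℂ A c) F)
    {p : Fin N → ℂ} (hp : Function.Injective p) {S : Submodule ℂ A} {y : A} (hy : y ∈ S)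
    (h : ∀ m, F (p m) * y ∈ S) (x : ℂ) : F x * y ∈ S := by
  have hF' : IsPolyWithLead (Fintype.card (Fin N)) (algebraMap ℂ A c) F := by
    rwa [Fintype.card_fin]
  rw [hF'.interpolation hp x, Algebra.algebraMap_eq_smul_one, add_mul, sum_mul]
  refine add_mem ?_ (sum_mem fun m _ => ?_)
  · rw [smul_smul, smul_mul_assoc, one_mul]; exact Submodule.smul_mem _ _ hy
  · rw [smul_mul_assoc]; exact Submodule.smul_mem _ _ (h m)

theorem IsPolyWithLead.mul_sub_mem {F : ℂ → A} {c : ℂ}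
    (hF : IsPolyWithLead N (algebraMap ℂ A c) F)
    {p : Fin N → ℂ} (hp : Function.Injective p) {S : Submodule ℂ A} {y : A} (hy : y ∈ S)
    (a : Fin N) (h : ∀ m, m ≠ a → F (p m) * y ∈ S) (x : ℂ) :
    F x * y - lagr p x a • (F (p a) * y) ∈ S := by
  have hF' : IsPolyWithLead (Fintype.card (Fin N)) (algebraMap ℂ A c) F := by
    rwa [Fintype.card_fin]
  rw [hF'.interpolation hp x, Algebra.algebraMap_eq_smul_one, add_mul, sum_mul,
    ← add_sum_erase _ _ (mem_univ a), smul_mul_assoc, smul_mul_assoc, smul_mul_assoc, one_mul,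
    add_sub_assoc, add_sub_cancel_left]
  refine add_mem (Submodule.smul_mem _ _ (Submodule.smul_mem _ _ hy)) (sum_mem fun m hm => ?_)
  rw [smul_mul_assoc]; exact Submodule.smul_mem _ _ (h m (ne_of_mem_erase hm))

namespace FusionSystem

variable (hS : FusionSystem η ξ T t) (hη : η ≠ 0) (hξ : InhomCond η ξ)
include hS hη hξ

theorem mul_covMon_mem (D : ℕ) : ∀ k : St N, ∑ n, labelDeg (k n) ≤ D →
    (∀ x, T x * covMon η ξ T t k ∈ filt η ξ T t (D + 1)) ∧
      ∀ x, t x * covMon η ξ T t k ∈ filt η ξ T t (D + 2) := by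
  induction D using Nat.strong_induction_on with
  | _ D ih =>
  intro k hk
  obtain ⟨cT, hT⟩ := hS.poly_T
  obtain ⟨ct, ht⟩ := hS.poly_t
  have le_deg : ∀ m, labelDeg (k m) ≤ D := fun m =>
    (single_le_sum (f := fun n => labelDeg (k n)) (fun _ _ => Nat.zero_le _) (mem_univ m)).trans hk
  have hX := covMon_mem_filt (η := η) (ξ := ξ) (T := T) (t := t) hk
  constructor
  · refine hT.mul_mem (injective_sub_mul hξ fun m => k m ≠ 2) (filt_mono (Nat.le_succ D) hX)
      fun m => ?_
    have hm := le_deg m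
    rw [covMon_eq k m]
    obtain h | h | h : k m = 0 ∨ k m = 1 ∨ k m = 2 := by
      generalize k m = i; fin_cases i <;> simp
    · obtain ⟨q, hq⟩ := hS.qdet m
      have := covMon_update_mem_filt (η := η) (ξ := ξ) (T := T) (t := t) (E := D + 1) hk m 1
        (by simp [h, labelDeg]; omega)
      simp only [h, covSite, Matrix.cons_val, one_mul, ne_eq, Fin.isValue, zero_mul, sub_zero,
        not_false_eq_true, if_true, Fin.reduceEq] at this ⊢
      rw [← mul_assoc, hq, ← Algebra.smul_def]
      exact Submodule.smul_mem _ _ this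
    · have := covMon_update_mem_filt (η := η) (ξ := ξ) (T := T) (t := t) (E := D + 1) hk m 2
        (by simp [h, labelDeg])
      simpa [h, covSite] using this
    · have h1 : 1 ≤ D := by simpa [h, labelDeg] using hm
      have := (ih (D - 1) (by omega) (Function.update k m 1) (by
        have := sum_labelDeg_update k m 1; simp [h, labelDeg] at this hk ⊢; omega)).2 (ξ m)
      rw [covMon_update, show D - 1 + 2 = D + 1 by omega] at this
      simp only [h, covSite, Matrix.cons_val, one_mul, ne_eq, Fin.isValue, not_true_eq_false,
        if_false] at this ⊢
      rw [← mul_assoc, mul_comm (T _) (T _), hS.fusion, smul_mul_assoc]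
      exact Submodule.smul_mem _ _ this
  · refine ht.mul_mem (injective_sub_mul hξ fun m => k m = 0)
      (filt_mono (Nat.le_add_right D 2) hX) fun m => ?_
    have hm := le_deg m
    rw [covMon_eq k m]
    obtain h | h | h : k m = 0 ∨ k m = 1 ∨ k m = 2 := by
      generalize k m = i; fin_cases i <;> simp
    · have h1 : 2 ≤ D := by simpa [h, labelDeg] using hm
      have := (ih (D - 2) (by omega) (Function.update k m 1) (by
        have := sum_labelDeg_update k m 1; simp [h, labelDeg] at this hk ⊢; omega)).1 (ξ m - η)
      rw [covMon_update] at this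
      obtain ⟨q, hq⟩ := hS.qdet m
      have hd := dfun_sub_ne_zero hη hξ m
      simp only [h, covSite, Matrix.cons_val, one_mul, Fin.isValue, zero_mul, sub_zero,
        if_true] at this ⊢
      rw [← inv_smul_smul₀ hd (t (ξ m)), ← hS.fusion, smul_mul_assoc,
        show T (ξ m) * T (ξ m - η) * (t (ξ m - η) * covRest η ξ T t k m) =
          (T (ξ m) * t (ξ m - η)) * (T (ξ m - η) * covRest η ξ T t k m) by ring, hq,
        ← Algebra.smul_def]
      exact Submodule.smul_mem _ _ (Submodule.smul_mem _ _ (filt_mono (by omega) this))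
    · have := covMon_update_mem_filt (η := η) (ξ := ξ) (T := T) (t := t) (E := D + 2) hk m 0
        (by simp [h, labelDeg])
      simpa [h, covSite] using this
    · obtain ⟨q, hq⟩ := hS.qdet m
      have := covMon_update_mem_filt (η := η) (ξ := ξ) (T := T) (t := t) (E := D + 2) hk m 1
        (by simp [h, labelDeg]; omega)
      simp only [h, covSite, Matrix.cons_val, one_mul, Fin.isValue,
        if_false, Fin.reduceEq] at this ⊢
      rw [← mul_assoc, mul_comm (t _), hq, ← Algebra.smul_def]
      exact Submodule.smul_mem _ _ this

theorem T_mem_mulFilt (x : ℂ) : T x ∈ mulFilt η ξ T t 1 := fun D _ hy =>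
  filt_le_comap (fun k hk => (hS.mul_covMon_mem hη hξ D k hk).1 x) hy

theorem t_mem_mulFilt (x : ℂ) : t x ∈ mulFilt η ξ T t 2 := fun D _ hy =>
  filt_le_comap (fun k hk => (hS.mul_covMon_mem hη hξ D k hk).2 x) hy

end FusionSystem

theorem mulFilt_mono {D E : ℕ} (h : D ≤ E) : mulFilt η ξ T t D ≤ mulFilt η ξ T t E :=
  fun _ hy F x hx => filt_mono (by omega) (hy F x hx)

theorem one_mem_mulFilt : (1 : A) ∈ mulFilt η ξ T t 0 := fun E x hx => by simpa using hx

theorem algebraMap_mem_mulFilt (q : ℂ) : algebraMap ℂ A q ∈ mulFilt η ξ T t 0 := by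
  rw [Algebra.algebraMap_eq_smul_one]; exact Submodule.smul_mem _ _ one_mem_mulFilt

theorem mul_mem_mulFilt {D E : ℕ} {x y : A} (hx : x ∈ mulFilt η ξ T t D)
    (hy : y ∈ mulFilt η ξ T t E) : x * y ∈ mulFilt η ξ T t (D + E) := fun F z hz => by
  rw [mul_assoc]; have := hx _ _ (hy F z hz); rwa [add_assoc, add_comm E D] at this

theorem prod_mem_mulFilt {s : Finset (Fin N)} {g : Fin N → A} {w : ℕ}
    (hg : ∀ m ∈ s, g m ∈ mulFilt η ξ T t w) : ∏ m ∈ s, g m ∈ mulFilt η ξ T t (w * #s) := by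
  induction s using Finset.induction_on with
  | empty => simpa using one_mem_mulFilt
  | insert a s ha ih =>
    rw [prod_insert ha, card_insert_of_notMem ha, mul_add, mul_one, add_comm]
    exact mul_mem_mulFilt (hg a (mem_insert_self _ _))
      (ih fun m hm => hg m (mem_insert_of_mem hm))

theorem mul_prod_mem_mulFilt {s : Finset (Fin N)} {g : Fin N → A} {w v : ℕ}
    (hg : ∀ m ∈ s, g m ∈ mulFilt η ξ T t w) {j : Fin N} (hj : j ∈ s) {y : A}
    (hy : y * g j ∈ mulFilt η ξ T t v) :
    y * ∏ m ∈ s, g m ∈ mulFilt η ξ T t (v + w * (#s - 1)) := by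
  rw [← mul_prod_erase _ _ hj, ← mul_assoc, ← card_erase_of_mem hj]
  exact mul_mem_mulFilt hy (prod_mem_mulFilt fun m hm => hg m (mem_of_mem_erase hm))

theorem mulFilt_le_filt (D : ℕ) : mulFilt η ξ T t D ≤ filt η ξ T t D := fun y hy => by
  have h1 : (1 : A) ∈ filt η ξ T t 0 := by
    have := covMon_mem_filt (η := η) (ξ := ξ) (T := T) (t := t) (k := fun _ => 1) (D := 0)
      (by simp [labelDeg])
    simpa [covMon, covSite] using this
  simpa using hy 0 1 h1

theorem eq_zero_of_mem_filt (φ : A →ₗ[ℂ] ℂ)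
    (hφ : ∀ k, k ≠ zeroSt → φ (covMon η ξ T t k) = 0) {D : ℕ} (hD : D < 2 * N) {y : A}
    (hy : y ∈ filt η ξ T t D) : φ y = 0 := by
  have hle : filt η ξ T t D ≤ LinearMap.ker φ := by
    refine Submodule.span_le.2 ?_
    rintro _ ⟨k, hk, rfl⟩
    refine hφ k fun h => ?_
    subst h
    simp [zeroSt, labelDeg] at hk
    omega
  exact hle hy

variable (η ξ T t) in
/-- Product of the co-vector and vector factors at one site, up to a normalization. -/
def diagSite (n : Fin N) : Fin 3 → A := ![t (ξ n - η), t (ξ n), T (ξ n) ^ 2]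

omit [Algebra ℂ A] in
theorem diagSite_zero (n : Fin N) : diagSite η ξ T t n 0 = t (ξ n - η) := rfl

omit [Algebra ℂ A] in
theorem diagSite_two (n : Fin N) : diagSite η ξ T t n 2 = T (ξ n) ^ 2 := rfl

variable (η ξ T t) in
/-- Product of the co-vector and vector monomials of the same label, up to a normalization. -/
def diagMon (h : St N) : A := ∏ n, diagSite η ξ T t n (h n)

omit [Algebra ℂ A] in
theorem diagMon_eq (h : St N) (a : Fin N) : diagMon η ξ T t h =
    diagSite η ξ T t a (h a) * ∏ n ∈ univ.erase a, diagSite η ξ T t n (h n) :=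
  (mul_prod_erase univ (fun n => diagSite η ξ T t n (h n)) (mem_univ a)).symm

omit [Algebra ℂ A] in
theorem diagMon_update (h : St N) (a : Fin N) (i : Fin 3) :
    diagMon η ξ T t (Function.update h a i) =
      diagSite η ξ T t a i * ∏ n ∈ univ.erase a, diagSite η ξ T t n (h n) := by
  rw [diagMon_eq _ a, Function.update_self]
  congr 1
  refine prod_congr rfl fun n hn => ?_
  rw [Function.update_of_ne (ne_of_mem_erase hn)]

namespace FusionSystem

variable (hS : FusionSystem η ξ T t) (hη : η ≠ 0) (hξ : InhomCond η ξ)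
include hS hη hξ

theorem diagSite_mem_mulFilt (n : Fin N) (i : Fin 3) :
    diagSite η ξ T t n i ∈ mulFilt η ξ T t 2 := by
  have h1 := hS.T_mem_mulFilt hη hξ
  have h2 := hS.t_mem_mulFilt hη hξ
  fin_cases i
  · exact h2 _
  · exact h2 _
  · have := mul_mem_mulFilt (h1 (ξ n)) (h1 (ξ n))
    rwa [← sq] at this

omit hη hξ in
theorem t_mul_T_mem (n : Fin N) : t (ξ n - η) * T (ξ n) ∈ mulFilt η ξ T t 0 := by
  obtain ⟨q, hq⟩ := hS.qdet n
  rw [mul_comm, hq]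
  exact algebraMap_mem_mulFilt q

theorem t_mul_t_mem (n : Fin N) : t (ξ n - η) * t (ξ n) ∈ mulFilt η ξ T t 1 := by
  have e : t (ξ n - η) * t (ξ n) =
      (dfun ξ (ξ n - η))⁻¹ • (t (ξ n - η) * T (ξ n) * T (ξ n - η)) := by
    rw [eq_inv_smul_iff₀ (dfun_sub_ne_zero hη hξ n), ← mul_smul_comm, ← hS.fusion, mul_assoc]
  have h := mul_mem_mulFilt (hS.t_mul_T_mem n) (hS.T_mem_mulFilt hη hξ (ξ n - η))
  rw [e]
  exact Submodule.smul_mem _ _ h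

theorem t_mul_diagSite_mem (n : Fin N) (i : Fin 3) :
    t (ξ n - (if i = 0 then 0 else 1) * η) * diagSite η ξ T t n i ∈ mulFilt η ξ T t 1 := by
  have h1 := hS.T_mem_mulFilt hη hξ
  fin_cases i
  · simpa [diagSite, mul_comm] using hS.t_mul_t_mem hη hξ n
  · simpa [diagSite] using hS.t_mul_t_mem hη hξ n
  · have := mul_mem_mulFilt (hS.t_mul_T_mem n) (h1 (ξ n))
    simpa [diagSite, sq, mul_assoc] using this

theorem t_mul_prod_sub_mem (h : St N) (a : Fin N) (ha : h a ≠ 0) :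
    t (ξ a) * ∏ n ∈ univ.erase a, diagSite η ξ T t n (h n) -
      lagr (fun m => ξ m - (if h m = 0 then 0 else 1) * η) (ξ a) a •
        (t (ξ a - η) * ∏ n ∈ univ.erase a, diagSite η ξ T t n (h n)) ∈
      mulFilt η ξ T t (2 * N - 1) := by
  have hN : 0 < N := a.pos
  obtain ⟨c, ht⟩ := hS.poly_t
  have hg : ∀ m ∈ univ.erase a, diagSite η ξ T t m (h m) ∈ mulFilt η ξ T t 2 :=
    fun m _ => hS.diagSite_mem_mulFilt hη hξ m _
  have hcard : #(univ.erase a) = N - 1 := by simp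
  have := ht.mul_sub_mem (injective_sub_mul hξ fun m => h m = 0)
    (mulFilt_mono (E := 2 * N - 1) (by omega) (prod_mem_mulFilt hg)) a (fun m hm => ?_) (ξ a)
  · simpa only [ha, if_false, one_mul] using this
  · have hm' : m ∈ univ.erase a := by simp [hm]
    exact mulFilt_mono (by omega)
      (mul_prod_mem_mulFilt hg hm' (hS.t_mul_diagSite_mem hη hξ m (h m)))

theorem T_mul_prod_sub_mem (h : St N) (h1 : ∀ n, h n ≠ 1) (a : Fin N) (ha : h a = 2) :
    T (ξ a) ^ 2 * ∏ n ∈ univ.erase a, diagSite η ξ T t n (h n) -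
      lagr (fun m => ξ m - (if h m = 0 then 0 else 1) * η) (ξ a) a •
        (dfun ξ (ξ a - η) • (t (ξ a) * ∏ n ∈ univ.erase a, diagSite η ξ T t n (h n))) ∈
      mulFilt η ξ T t (2 * N - 1) := by
  have hN : 0 < N := a.pos
  obtain ⟨c, hT⟩ := hS.poly_T
  obtain ⟨c', ht⟩ := hS.poly_t
  have wT := hS.T_mem_mulFilt hη hξ
  have hg : ∀ s : Finset (Fin N), ∀ m ∈ s, diagSite η ξ T t m (h m) ∈ mulFilt η ξ T t 2 :=
    fun s m _ => hS.diagSite_mem_mulFilt hη hξ m _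
  have hcard : #(univ.erase a) = N - 1 := by simp
  have hp := injective_sub_mul hξ fun m => h m = 0
  have := hT.mul_sub_mem hp (S := mulFilt η ξ T t (2 * N - 1))
    (y := T (ξ a) * ∏ n ∈ univ.erase a, diagSite η ξ T t n (h n))
    (mulFilt_mono (by omega) (mul_mem_mulFilt (wT _) (prod_mem_mulFilt (hg _))))
    a (fun m hm => ?_) (ξ a)
  · have e : T (ξ a - η) * (T (ξ a) * ∏ n ∈ univ.erase a, diagSite η ξ T t n (h n)) =
        dfun ξ (ξ a - η) • (t (ξ a) * ∏ n ∈ univ.erase a, diagSite η ξ T t n (h n)) := by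
      rw [← mul_assoc, mul_comm (T _) (T _), hS.fusion, smul_mul_assoc]
    have e2 : T (ξ a) * (T (ξ a) * ∏ n ∈ univ.erase a, diagSite η ξ T t n (h n)) =
        T (ξ a) ^ 2 * ∏ n ∈ univ.erase a, diagSite η ξ T t n (h n) := by ring
    simpa only [ha, Fin.reduceEq, if_false, one_mul, e, e2] using this
  · have hm' : m ∈ univ.erase a := by simp [hm]
    have hcard' : #((univ.erase a).erase m) = N - 2 := by
      rw [card_erase_of_mem hm', hcard]; omega
    have hN2 : 2 ≤ N := by
      have : 0 < #(univ.erase a) := card_pos.2 ⟨m, hm'⟩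
      omega
    obtain h0 | h0 | h0 : h m = 0 ∨ h m = 1 ∨ h m = 2 := by
      generalize h m = i; fin_cases i <;> simp
    · simp only [h0, if_true, zero_mul, sub_zero]
      rw [mul_left_comm]
      obtain ⟨q, hq⟩ := hS.qdet m
      refine mulFilt_mono ?_ (mul_mem_mulFilt (wT _) (mul_prod_mem_mulFilt (v := 0) (hg _) hm' ?_))
      · omega
      · simp only [h0, diagSite, Matrix.cons_val]
        rw [hq]; exact algebraMap_mem_mulFilt q
    · exact absurd h0 (h1 m)
    · simp only [h0, Fin.reduceEq, if_false, one_mul]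
      rw [← mul_prod_erase _ _ hm', h0]
      rw [diagSite_two]
      set P := ∏ n ∈ (univ.erase a).erase m, diagSite η ξ T t n (h n) with hP
      rw [show T (ξ m - η) * (T (ξ a) * (T (ξ m) ^ 2 * P)) =
        (T (ξ m) * T (ξ m - η)) * (T (ξ m) * T (ξ a) * P) by ring, hS.fusion, smul_mul_assoc]
      have wP : P ∈ mulFilt η ξ T t (2 * (N - 2)) := hcard' ▸ prod_mem_mulFilt (hg _)
      refine Submodule.smul_mem _ _ (ht.mul_mem hp ?_ (fun j => ?_) _)
      · exact mulFilt_mono (by omega) (mul_mem_mulFilt (mul_mem_mulFilt (wT _) (wT _)) wP)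
      · by_cases hjm : j = m
        · subst hjm
          simp only [h0, Fin.reduceEq, if_false, one_mul]
          rw [← mul_assoc, ← mul_assoc]
          exact mulFilt_mono (by omega)
            (mul_mem_mulFilt (mul_mem_mulFilt (hS.t_mul_T_mem j) (wT _)) wP)
        · by_cases hja : j = a
          · subst hja
            simp only [ha, Fin.reduceEq, if_false, one_mul]
            rw [mul_comm (T (ξ m)), ← mul_assoc, ← mul_assoc]
            exact mulFilt_mono (by omega)
              (mul_mem_mulFilt (mul_mem_mulFilt (hS.t_mul_T_mem j) (wT _)) wP)
          · rw [mul_left_comm]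
            have hj : j ∈ (univ.erase a).erase m := by simp [hjm, hja]
            have := card_pos.2 ⟨j, hj⟩
            exact mulFilt_mono (by omega) (mul_mem_mulFilt (mul_mem_mulFilt (wT _) (wT _))
              (mul_prod_mem_mulFilt (hg _) hj (hS.t_mul_diagSite_mem hη hξ j (h j))))

variable {φ : A →ₗ[ℂ] ℂ} (hφ : ∀ k, k ≠ zeroSt → φ (covMon η ξ T t k) = 0)
include hφ

theorem map_diagMon_of_eq_one (h : St N) (a : Fin N) (ha : h a = 1) :
    φ (diagMon η ξ T t h) = lagr (fun m => ξ m - (if h m = 0 then 0 else 1) * η) (ξ a) a *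
      φ (diagMon η ξ T t (Function.update h a 0)) := by
  have hN : 0 < N := a.pos
  have := eq_zero_of_mem_filt φ hφ (D := 2 * N - 1) (by omega)
    (mulFilt_le_filt _ (hS.t_mul_prod_sub_mem hη hξ h a (by simp [ha])))
  rw [map_sub, map_smul, smul_eq_mul, sub_eq_zero] at this
  rw [diagMon_eq h a, diagMon_update, ha]
  exact this

theorem map_diagMon_of_eq_two (h : St N) (h1 : ∀ n, h n ≠ 1) (a : Fin N) (ha : h a = 2) :
    φ (diagMon η ξ T t h) = dfun ξ (ξ a - η) *
      lagr (fun m => ξ m - (if h m = 0 then 0 else 1) * η) (ξ a) a ^ 2 *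
      φ (diagMon η ξ T t (Function.update h a 0)) := by
  have hN : 0 < N := a.pos
  have e1 := eq_zero_of_mem_filt φ hφ (D := 2 * N - 1) (by omega)
    (mulFilt_le_filt _ (hS.t_mul_prod_sub_mem hη hξ h a (by simp [ha])))
  have e2 := eq_zero_of_mem_filt φ hφ (D := 2 * N - 1) (by omega)
    (mulFilt_le_filt _ (hS.T_mul_prod_sub_mem hη hξ h h1 a ha))
  rw [map_sub, map_smul, smul_eq_mul, sub_eq_zero] at e1 e2
  rw [map_smul, smul_eq_mul, e1] at e2
  rw [diagMon_eq h a, diagMon_update, ha]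
  rw [diagSite_zero, diagSite_two, e2]
  ring

end FusionSystem

end FusionSystem

section SiteAlgebra

variable {R : Type*} [Ring R]

/-- Every entry of `X` commutes with every entry of `Y`. -/
def EntriesCommute (X Y : Matrix (Fin 3) (Fin 3) R) : Prop :=
  ∀ i j k l, Commute (X i j) (Y k l)

theorem EntriesCommute.symm {X Y : Matrix (Fin 3) (Fin 3) R} (h : EntriesCommute X Y) :
    EntriesCommute Y X := fun i j k l => (h k l i j).symm

theorem EntriesCommute.mul_left {X X' Y : Matrix (Fin 3) (Fin 3) R} (h : EntriesCommute X Y)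
    (h' : EntriesCommute X' Y) : EntriesCommute (X * X') Y := fun i j k l => by
  rw [Matrix.mul_apply]
  exact Commute.sum_left _ _ _ fun p _ => (h i p k l).mul_left (h' p j k l)

theorem EntriesCommute.mul_right {X Y Y' : Matrix (Fin 3) (Fin 3) R} (h : EntriesCommute X Y)
    (h' : EntriesCommute X Y') : EntriesCommute X (Y * Y') :=
  (h.symm.mul_left h'.symm).symm

theorem entriesCommute_list_prod_left {L : List (Matrix (Fin 3) (Fin 3) R)}
    {Y : Matrix (Fin 3) (Fin 3) R} (h : ∀ X ∈ L, EntriesCommute X Y) :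
    EntriesCommute L.prod Y := by
  induction L with
  | nil =>
    intro i j k l
    rw [List.prod_nil, Matrix.one_apply]
    split_ifs
    · exact Commute.one_left _
    · exact Commute.zero_left _
  | cons X L ih =>
    rw [List.prod_cons]
    exact (h X (List.mem_cons_self ..)).mul_left (ih fun Z hZ => h Z (List.mem_cons_of_mem _ hZ))

/-- `X_{ij} Y_{kl}` symmetrized in `i, k`. -/
def symEntry (X Y : Matrix (Fin 3) (Fin 3) R) (i k j l : Fin 3) : R :=
  X i j * Y k l + X k j * Y i l

theorem symEntry_mul {X Y X' Y' : Matrix (Fin 3) (Fin 3) R} (hc : EntriesCommute X' Y)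
    (i k j l : Fin 3) :
    symEntry (X * X') (Y * Y') i k j l =
      ∑ p, ∑ q, symEntry X Y i k p q * (X' p j * Y' q l) := by
  simp only [symEntry, Matrix.mul_apply, sum_mul_sum, ← sum_add_distrib]
  refine sum_congr rfl fun p _ => sum_congr rfl fun q _ => ?_
  rw [add_mul]
  congr 1
  · rw [mul_assoc, mul_assoc, ← mul_assoc (X' p j), (hc p j k q).eq, mul_assoc]
  · rw [mul_assoc, mul_assoc, ← mul_assoc (X' p j), (hc p j i q).eq, mul_assoc]

theorem symEntry_mul_eq_zero {X Y X' Y' : Matrix (Fin 3) (Fin 3) R} (hc : EntriesCommute X' Y)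
    (h : ∀ i k j l, symEntry X Y i k j l = 0) (i k j l : Fin 3) :
    symEntry (X * X') (Y * Y') i k j l = 0 := by
  simp [symEntry_mul hc, h]

variable [Algebra ℂ R]

theorem symEntry_mul_eq_zero_of_symm {X Y X' Y' : Matrix (Fin 3) (Fin 3) R}
    (hc : EntriesCommute X' Y) (hs : ∀ i k j l, symEntry X Y i k j l = symEntry X Y i k l j)
    (h : ∀ i k j l, symEntry X' Y' i k j l = 0) (i k j l : Fin 3) :
    symEntry (X * X') (Y * Y') i k j l = 0 := by
  rw [symEntry_mul hc]
  set S := ∑ p, ∑ q, symEntry X Y i k p q * (X' p j * Y' q l) with hS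
  have h2 : S + S = 0 := by
    nth_rw 2 [hS]
    rw [sum_comm, hS, ← sum_add_distrib]
    refine sum_eq_zero fun p _ => ?_
    rw [← sum_add_distrib]
    refine sum_eq_zero fun q _ => ?_
    rw [hs i k q p, ← mul_add]
    have := h p q j l
    rw [symEntry] at this
    rw [this, mul_zero]
  rw [← two_smul ℂ] at h2
  have h3 := congrArg (fun z => (2 : ℂ)⁻¹ • z) h2
  simpa [smul_smul] using h3

/-- The exchange relation `R(c) X₁ Y₂ = Y₂ X₁ R(c)` for `R(c) = c + η P`. -/
def Exchange (η c : ℂ) (X Y : Matrix (Fin 3) (Fin 3) R) : Prop :=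
  ∀ i j k l, c • (X i j * Y k l) + η • (X k j * Y i l) =
    c • (Y k l * X i j) + η • (Y k j * X i l)

theorem Exchange.mul {η c : ℂ} {X Y X' Y' : Matrix (Fin 3) (Fin 3) R} (h : Exchange η c X Y)
    (h' : Exchange η c X' Y') (hXY : EntriesCommute X' Y) (hYX : EntriesCommute Y' X) :
    Exchange η c (X * X') (Y * Y') := by
  intro i j k l
  have hL : ∀ i k j l, (X * X') i j * (Y * Y') k l =
      ∑ a, ∑ b, X i a * Y k b * (X' a j * Y' b l) := fun i k j l => by
    simp only [Matrix.mul_apply, sum_mul_sum]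
    refine sum_congr rfl fun a _ => sum_congr rfl fun b _ => ?_
    rw [mul_assoc, mul_assoc, ← mul_assoc (X' a j), (hXY a j k b).eq, mul_assoc]
  have hR : ∀ i k j l, (Y * Y') k l * (X * X') i j =
      ∑ a, ∑ b, Y k b * X i a * (Y' b l * X' a j) := fun i k j l => by
    simp only [Matrix.mul_apply, sum_mul_sum]
    rw [sum_comm]
    refine sum_congr rfl fun a _ => sum_congr rfl fun b _ => ?_
    rw [mul_assoc, mul_assoc, ← mul_assoc (Y' b l), (hYX b l i a).eq, mul_assoc]
  have h1 : c • ((X * X') i j * (Y * Y') k l) + η • ((X * X') k j * (Y * Y') i l) =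
      ∑ a, ∑ b, (c • (Y k b * X i a) + η • (Y k a * X i b)) * (X' a j * Y' b l) := by
    simp only [hL, smul_sum, ← sum_add_distrib, ← h i _ k _, add_mul, smul_mul_assoc]
  have h2 : ∑ a, ∑ b, (η • (Y k a * X i b)) * (X' a j * Y' b l) =
      ∑ a, ∑ b, (Y k b * X i a) * (η • (X' b j * Y' a l)) := by
    rw [sum_comm]; simp only [smul_mul_assoc, mul_smul_comm]
  have h3 : c • ((Y * Y') k l * (X * X') i j) + η • ((Y * Y') k j * (X * X') i l) =
      ∑ a, ∑ b, (Y k b * X i a) * (c • (Y' b l * X' a j) + η • (Y' b j * X' a l)) := by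
    simp only [hR, smul_sum, ← sum_add_distrib, mul_add, mul_smul_comm]
  rw [h1, h3]
  simp only [add_mul, sum_add_distrib]
  rw [h2]
  simp only [← sum_add_distrib]
  refine sum_congr rfl fun a _ => sum_congr rfl fun b _ => ?_
  rw [smul_mul_assoc, ← mul_smul_comm, ← mul_add, h' a j b l]

/-- Matrix with scalar entries. -/
def scalarMat (K : Matrix (Fin 3) (Fin 3) ℂ) : Matrix (Fin 3) (Fin 3) R :=
  K.map (algebraMap ℂ R)

theorem scalarMat_entriesCommute (K : Matrix (Fin 3) (Fin 3) ℂ) (Y : Matrix (Fin 3) (Fin 3) R) :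
    EntriesCommute (scalarMat K) Y := fun _ _ _ _ => Algebra.commutes _ _

theorem scalarMat_one : (scalarMat 1 : Matrix (Fin 3) (Fin 3) R) = 1 := by
  simp [scalarMat]

theorem exchange_scalarMat (η c : ℂ) (K : Matrix (Fin 3) (Fin 3) ℂ) :
    Exchange η c (scalarMat K : Matrix (Fin 3) (Fin 3) R) (scalarMat K) := fun i j k l => by
  rw [(scalarMat_entriesCommute K (scalarMat K : Matrix (Fin 3) (Fin 3) R) i j k l).eq]

theorem Exchange.symEntry_comm {η : ℂ} (hη : η ≠ 0) {X Y : Matrix (Fin 3) (Fin 3) R}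
    (h : Exchange η η X Y) (i k j l : Fin 3) : symEntry X Y i k j l = symEntry X Y i k l j := by
  have h1 := h i j k l
  have h2 := h i l k j
  rw [add_comm (η • (Y k j * X i l)), ← h1, ← smul_add, ← smul_add] at h2
  exact (smul_right_injective R hη h2).symm

theorem Exchange.commute_trace {η c : ℂ} {X Y : Matrix (Fin 3) (Fin 3) R}
    (h : Exchange η c X Y) (hc : c ^ 2 ≠ η ^ 2) : Commute X.trace Y.trace := by
  have e1 : c • (X.trace * Y.trace) + η • ∑ i, ∑ k, X k i * Y i k =
      c • (Y.trace * X.trace) + η • ∑ i, ∑ k, Y k i * X i k := by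
    have : Y.trace * X.trace = ∑ i, ∑ k, Y k k * X i i := by
      simp only [Matrix.trace, Matrix.diag, sum_mul_sum]; rw [sum_comm]
    rw [this]
    simp only [Matrix.trace, Matrix.diag, sum_mul_sum, smul_sum, ← sum_add_distrib]
    exact sum_congr rfl fun i _ => sum_congr rfl fun k _ => h i i k k
  have e2 : c • ∑ i, ∑ k, X k i * Y i k + η • (X.trace * Y.trace) =
      c • ∑ i, ∑ k, Y k i * X i k + η • (Y.trace * X.trace) := by
    have h1 : ∑ i, ∑ k, Y k i * X i k = ∑ i, ∑ k, Y i k * X k i := sum_comm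
    have h2 : X.trace * Y.trace = ∑ i, ∑ k, X i i * Y k k := by
      simp only [Matrix.trace, Matrix.diag, sum_mul_sum]
    have h3 : Y.trace * X.trace = ∑ i, ∑ k, Y i i * X k k := by
      simp only [Matrix.trace, Matrix.diag, sum_mul_sum]
    rw [h1, h2, h3]
    simp only [smul_sum, ← sum_add_distrib]
    exact sum_congr rfl fun i _ => sum_congr rfl fun k _ => h k i i k
  set S := ∑ i, ∑ k, X k i * Y i k
  set S' := ∑ i, ∑ k, Y k i * X i k
  have e3 : (c ^ 2 - η ^ 2) • (X.trace * Y.trace - Y.trace * X.trace) = 0 := by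
    have e1' : c • (X.trace * Y.trace - Y.trace * X.trace) = η • (S' - S) := by
      rw [smul_sub, smul_sub, sub_eq_sub_iff_add_eq_add, e1]; abel
    have e2' : c • (S' - S) = η • (X.trace * Y.trace - Y.trace * X.trace) := by
      rw [smul_sub, smul_sub, sub_eq_sub_iff_add_eq_add, add_comm (η • _), e2]
    rw [sub_smul, pow_two, pow_two, mul_smul, mul_smul, e1', smul_comm, e2', sub_self]
  exact sub_eq_zero.1 ((smul_eq_zero.1 e3).resolve_left (sub_ne_zero.2 hc))

theorem sum_comm_pairs {M : Type*} [AddCommMonoid M] (f : Fin 3 → Fin 3 → Fin 3 → Fin 3 → M) :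
    ∑ j, ∑ l, ∑ p, ∑ q, f j l p q = ∑ p, ∑ q, ∑ j, ∑ l, f j l p q := by
  have h := sum_comm (s := univ) (t := univ)
    (f := fun (x y : Fin 3 × Fin 3) => f x.1 x.2 y.1 y.2)
  simpa only [Fintype.sum_prod_type] using h

/-- The Levi-Civita symbol. -/
def leviCivita : Fin 3 → Fin 3 → Fin 3 → ℂ :=
  ![![![0, 0, 0], ![0, 0, 1], ![0, -1, 0]], ![![0, 0, -1], ![0, 0, 0], ![1, 0, 0]],
    ![![0, 1, 0], ![-1, 0, 0], ![0, 0, 0]]]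

/-- `Z` is the restriction of `X₁ Y₂` to antisymmetric tensors, identified with the dual of the
three-dimensional auxiliary space. -/
def Fuses (X Y Z : Matrix (Fin 3) (Fin 3) R) : Prop :=
  ∀ i k a, ∑ j, ∑ l, leviCivita j l a • (X i j * Y k l) = ∑ b, leviCivita i k b • Z b a

theorem Fuses.mul {X Y Z X' Y' Z' : Matrix (Fin 3) (Fin 3) R} (h : Fuses X Y Z)
    (h' : Fuses X' Y' Z') (hc : EntriesCommute X' Y) : Fuses (X * X') (Y * Y') (Z * Z') := by
  intro i k a
  have hL : ∀ j l, (X * X') i j * (Y * Y') k l =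
      ∑ p, ∑ q, X i p * Y k q * (X' p j * Y' q l) := fun j l => by
    simp only [Matrix.mul_apply, sum_mul_sum]
    refine sum_congr rfl fun p _ => sum_congr rfl fun q _ => ?_
    rw [mul_assoc, mul_assoc, ← mul_assoc (X' p j), (hc p j k q).eq, mul_assoc]
  calc ∑ j, ∑ l, leviCivita j l a • ((X * X') i j * (Y * Y') k l)
      = ∑ j, ∑ l, ∑ p, ∑ q, X i p * Y k q * (leviCivita j l a • (X' p j * Y' q l)) := by
        simp only [hL, smul_sum, mul_smul_comm]
    _ = ∑ p, ∑ q, X i p * Y k q * ∑ j, ∑ l, leviCivita j l a • (X' p j * Y' q l) := by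
        rw [sum_comm_pairs]
        simp only [mul_sum]
    _ = ∑ p, ∑ q, ∑ b, leviCivita p q b • (X i p * Y k q) * Z' b a := by
        simp_rw [h' _ _ a, mul_sum, mul_smul_comm, smul_mul_assoc]
    _ = ∑ b, (∑ p, ∑ q, leviCivita p q b • (X i p * Y k q)) * Z' b a := by
        simp_rw [sum_mul]
        rw [sum_congr rfl fun p _ => sum_comm, sum_comm]
    _ = ∑ b, leviCivita i k b • (Z * Z') b a := by
        simp_rw [h i k, sum_mul, Matrix.mul_apply, smul_sum, smul_mul_assoc]
        rw [sum_comm]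

theorem Fuses.trace_eq {X Y Z : Matrix (Fin 3) (Fin 3) R} (h : Fuses X Y Z) :
    X.trace * Y.trace - (∑ i, ∑ k, X k i * Y i k) = (2 : ℂ) • Z.trace := by
  have h0 := h 1 2 0
  have h1 := h 2 0 1
  have h2 := h 0 1 2
  have h0' := h 2 1 0
  have h1' := h 0 2 1
  have h2' := h 1 0 2
  simp only [Fin.sum_univ_three, leviCivita, Matrix.cons_val, zero_smul, one_smul, neg_smul,
    zero_add, add_zero] at h0 h1 h2 h0' h1' h2'
  have e : (2 : ℂ) • Z.trace =
      Z 0 0 + Z 1 1 + Z 2 2 - (-Z 0 0) - (-Z 1 1) - (-Z 2 2) := by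
    rw [Matrix.trace_fin_three]; module
  rw [e, ← h0', ← h1', ← h2', ← h0, ← h1, ← h2, Matrix.trace_fin_three, Matrix.trace_fin_three]
  simp only [Fin.sum_univ_three]
  noncomm_ring

theorem fuses_scalarMat (K : Matrix (Fin 3) (Fin 3) ℂ) :
    Fuses (scalarMat K : Matrix (Fin 3) (Fin 3) R) (scalarMat K)
      (scalarMat K.adjugate.transpose) := by
  intro i k a
  simp only [scalarMat, Matrix.map_apply, ← map_mul, ← map_sum, Algebra.smul_def,
    Matrix.transpose_apply]
  congr 1
  simp only [Fin.sum_univ_three, Matrix.adjugate_fin_three]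
  fin_cases i <;> fin_cases k <;> fin_cases a <;> simp [leviCivita] <;> ring

/-- `X` and the transpose of `Z` are inverse to each other up to the scalar `s`. -/
def CrossInverse (s : ℂ) (X Z : Matrix (Fin 3) (Fin 3) R) : Prop :=
  ∀ i a, ∑ j, X i j * Z a j = if i = a then algebraMap ℂ R s else 0

theorem CrossInverse.mul {s s' : ℂ} {X Z X' Z' : Matrix (Fin 3) (Fin 3) R}
    (h : CrossInverse s X Z) (h' : CrossInverse s' X' Z') (hc : EntriesCommute X' Z) :
    CrossInverse (s * s') (X * X') (Z * Z') := by
  intro i a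
  have hL : ∀ j, (X * X') i j * (Z * Z') a j =
      ∑ p, ∑ q, X i p * Z a q * (X' p j * Z' q j) := fun j => by
    simp only [Matrix.mul_apply, sum_mul_sum]
    refine sum_congr rfl fun p _ => sum_congr rfl fun q _ => ?_
    rw [mul_assoc, mul_assoc, ← mul_assoc (X' p j), (hc p j a q).eq, mul_assoc]
  simp only [hL]
  rw [sum_comm, sum_congr rfl fun p _ => sum_comm]
  simp only [← mul_sum, h' _ _, mul_ite, mul_zero, sum_ite_eq, mem_univ, if_true, ← sum_mul, h i a,
    ite_mul, zero_mul, map_mul]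

theorem crossInverse_scalarMat (K : Matrix (Fin 3) (Fin 3) ℂ) :
    CrossInverse K.det (scalarMat K : Matrix (Fin 3) (Fin 3) R)
      (scalarMat K.adjugate.transpose) := by
  intro i a
  simp only [scalarMat, Matrix.map_apply, ← map_mul, ← map_sum, Matrix.transpose_apply]
  rw [← Matrix.mul_apply, Matrix.mul_adjugate]
  by_cases h : i = a <;> simp [h]

/-- The rational Lax matrix, the components `x` being matrix units at one site. -/
def lax (η u : ℂ) (x : Fin 3 → Fin 3 → R) : Matrix (Fin 3) (Fin 3) R :=
  u • 1 + η • Matrix.of fun i j => x j i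

/-- The rational Lax matrix with dual auxiliary space. -/
def dualLax (η u : ℂ) (x : Fin 3 → Fin 3 → R) : Matrix (Fin 3) (Fin 3) R :=
  (u + η) • 1 - η • Matrix.of x

/-- Multiplication table of matrix units. -/
def IsMatrixUnits (x : Fin 3 → Fin 3 → R) : Prop :=
  ∀ i j k l, x i j * x k l = if j = k then x i l else 0

theorem exchange_lax (η u v : ℂ) {x : Fin 3 → Fin 3 → R} (hx : IsMatrixUnits x) :
    Exchange η (u - v) (lax η u x) (lax η v x) := by
  intro i j k l
  obtain ⟨d, hd⟩ : ∃ d : Fin 3 → Fin 3 → ℂ, ∀ a b, d a b = if a = b then 1 else 0 :=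
    ⟨_, fun _ _ => rfl⟩
  have hk (a b : Fin 3) (w : ℂ) : lax η w x a b = (w * d a b) • 1 + η • x b a := by
    simp [lax, Matrix.one_apply, hd]
  have hx' (a b a' b' : Fin 3) : x a b * x a' b' = d b a' • x a b' := by
    simp [hx _ _ _ _, hd]
  simp only [hk, add_mul, mul_add, smul_mul_assoc, mul_smul_comm, hx', one_mul, mul_one]
  module

theorem fuses_lax (η u : ℂ) {x : Fin 3 → Fin 3 → R} (hx : IsMatrixUnits x)
    (h1 : ∑ i, x i i = 1) :
    Fuses (lax η u x) (lax η (u - η) x) ((u - η) • dualLax η u x) := by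
  intro i k a
  have h2 : x 2 2 = 1 - x 0 0 - x 1 1 := by rw [← h1, Fin.sum_univ_three]; abel
  simp only [lax, dualLax, Matrix.add_apply, Matrix.sub_apply, Matrix.smul_apply,
    Matrix.one_apply, Matrix.of_apply, add_mul, mul_add, smul_mul_assoc, mul_smul_comm,
    hx _ _ _ _, ite_mul, mul_ite, one_mul, mul_one, zero_mul, mul_zero, Fin.sum_univ_three]
  fin_cases i <;> fin_cases k <;> fin_cases a <;> simp [leviCivita, h2] <;> module

theorem crossInverse_lax (η u : ℂ) {x : Fin 3 → Fin 3 → R} (hx : IsMatrixUnits x)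
    (h1 : ∑ i, x i i = 1) :
    CrossInverse (u ^ 2 - η ^ 2) (lax η u x) (dualLax η (u - η) x) := by
  intro i a
  have h2 : ∑ j, x j i * x a j = if i = a then 1 else 0 := by
    simp only [hx _ _ _ _]
    split_ifs <;> simp [h1]
  have hk (a b : Fin 3) : lax η u x a b = (if a = b then u else 0) • 1 + η • x b a := by
    simp [lax, Matrix.one_apply]
  have hk' (a b : Fin 3) :
      dualLax η (u - η) x a b = (if a = b then u else 0) • 1 - η • x a b := by
    simp [dualLax, Matrix.one_apply]
  simp only [hk, hk', add_mul, mul_sub, smul_mul_assoc, mul_smul_comm, one_mul, mul_one,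
    sum_add_distrib, sum_sub_distrib, ite_smul, zero_smul, sum_ite_eq, mem_univ, if_true,
    mul_ite, ite_mul, mul_zero, zero_mul, smul_ite, smul_zero, ← smul_sum, h2,
    Algebra.algebraMap_eq_smul_one]
  split_ifs <;> subst_vars <;> module

theorem symEntry_lax_zero (η : ℂ) {x : Fin 3 → Fin 3 → R} (hx : IsMatrixUnits x)
    (i k j l : Fin 3) : symEntry (lax η 0 x) (lax η (0 - η) x) i k j l = 0 := by
  simp only [symEntry, lax, Matrix.add_apply, Matrix.smul_apply, Matrix.one_apply,
    Matrix.of_apply, add_mul, mul_add, smul_mul_assoc, mul_smul_comm, hx _ _ _ _, ite_mul,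
    mul_ite, one_mul, mul_one, zero_mul, mul_zero]
  by_cases h2 : k = l <;> by_cases h4 : i = l <;> simp [h2, h4, eq_comm]

theorem trace_mul_trace_dual {η sA sB : ℂ} {x : Fin 3 → Fin 3 → R} (hx : IsMatrixUnits x)
    (h1 : ∑ i, x i i = 1) {A A' B B' : Matrix (Fin 3) (Fin 3) R} (hA : CrossInverse sA A A')
    (hB : CrossInverse sB B B') (hBA : EntriesCommute B A')
    (hAx : ∀ i j k l, Commute (A' i j) (x k l)) (hBx : ∀ i j k l, Commute (B i j) (x k l))
    (hBx' : ∀ i j k l, Commute (B' i j) (x k l)) :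
    (A * lax η 0 x * B).trace * (A' * dualLax η (0 - η) x * B').trace =
      algebraMap ℂ R (-(η ^ 2 * sA * sB)) := by
  have e1 : (A * lax η 0 x * B).trace = η • ∑ i, ∑ k, ∑ j, A i j * x k j * B k i := by
    simp [Matrix.trace, Matrix.mul_apply, lax, smul_sum, sum_mul]
  have e2 : (A' * dualLax η (0 - η) x * B').trace =
      -(η • ∑ a, ∑ c, ∑ b, A' a b * x b c * B' c a) := by
    simp [Matrix.trace, Matrix.mul_apply, dualLax, smul_sum, sum_mul]
  have e3 : ∀ i j k a b c, A i j * x k j * B k i * (A' a b * x b c * B' c a) =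
      if j = b then A i j * A' a j * (B k i * B' c a * x k c) else 0 := by
    intro i j k a b c
    rw [show A i j * x k j * B k i * (A' a b * x b c * B' c a) =
      A i j * (x k j * (B k i * A' a b)) * (x b c * B' c a) by noncomm_ring,
      (hBA k i a b).eq, ← mul_assoc (x k j), ← (hAx a b k j).eq, ← (hBx' c a b c).eq,
      show A i j * (A' a b * x k j * B k i) * (B' c a * x b c) =
        A i j * A' a b * (x k j * (B k i * B' c a) * x b c) by noncomm_ring,
      ← ((hBx k i k j).mul_left (hBx' c a k j)).eq, mul_assoc _ (x k j), hx]
    split_ifs with h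
    · rw [h]
    · simp
  rw [e1, e2]
  simp only [smul_mul_assoc, mul_neg, mul_smul_comm, sum_mul_sum, e3, sum_ite_eq, mem_univ,
    if_true]
  have e4 : ∀ i, ∑ a, ∑ k, ∑ c, ∑ j, A i j * A' a j * (B k i * B' c a * x k c) =
      sA • ∑ k, ∑ c, B k i * B' c i * x k c := by
    intro i
    simp only [← sum_mul, hA i _]
    simp only [← mul_sum]
    simp only [ite_mul, zero_mul, sum_ite_eq, mem_univ, if_true, Algebra.smul_def]
  have e5 : ∑ i, ∑ k, ∑ c, B k i * B' c i * x k c = algebraMap ℂ R sB := by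
    rw [sum_comm]
    have : ∀ k, ∑ i, ∑ c, B k i * B' c i * x k c = algebraMap ℂ R sB * x k k := by
      intro k
      rw [sum_comm]
      simp only [← sum_mul, hB k _, ite_mul, zero_mul, sum_ite_eq, mem_univ, if_true]
    simp only [this, ← mul_sum, h1, mul_one]
  simp only [e4, ← smul_sum, e5, Algebra.algebraMap_eq_smul_one]
  module

end SiteAlgebra

section Chain

variable {R : Type*} [Ring R] [Algebra ℂ R]

theorem entriesCommute_lax {η u : ℂ} {x : Fin 3 → Fin 3 → R} {Y : Matrix (Fin 3) (Fin 3) R}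
    (h : EntriesCommute (Matrix.of x) Y) : EntriesCommute (lax η u x) Y := fun i j k l => by
  have h1 : Commute (x j i) (Y k l) := h j i k l
  rw [lax, Matrix.add_apply, Matrix.smul_apply, Matrix.smul_apply, Matrix.one_apply]
  refine Commute.add_left (Commute.smul_left ?_ _) (h1.smul_left _)
  split_ifs
  · exact Commute.one_left _
  · exact Commute.zero_left _

theorem entriesCommute_dualLax {η u : ℂ} {x : Fin 3 → Fin 3 → R} {Y : Matrix (Fin 3) (Fin 3) R}
    (h : EntriesCommute (Matrix.of x) Y) : EntriesCommute (dualLax η u x) Y := fun i j k l => by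
  have h1 : Commute (x i j) (Y k l) := h i j k l
  rw [dualLax, Matrix.sub_apply, Matrix.smul_apply, Matrix.smul_apply, Matrix.one_apply]
  refine Commute.sub_left (Commute.smul_left ?_ _) (h1.smul_left _)
  split_ifs
  · exact Commute.one_left _
  · exact Commute.zero_left _

/-- Matrix units at each site of a chain, with commuting matrix units at different sites. -/
structure IsSiteUnits (e : Fin N → Fin 3 → Fin 3 → R) : Prop where
  units : ∀ n, IsMatrixUnits (e n)
  sum_diag : ∀ n, ∑ i, e n i i = 1
  commute : ∀ n m, n ≠ m → EntriesCommute (Matrix.of (e n)) (Matrix.of (e m))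

/-- Ordered product of Lax matrices over a list of sites. -/
def laxProd (η : ℂ) (ξ : Fin N → ℂ) (e : Fin N → Fin 3 → Fin 3 → R) (l : List (Fin N)) (x : ℂ) :
    Matrix (Fin 3) (Fin 3) R :=
  (l.map fun n => lax η (x - ξ n) (e n)).prod

/-- Ordered product of dual Lax matrices over a list of sites. -/
def dualLaxProd (η : ℂ) (ξ : Fin N → ℂ) (e : Fin N → Fin 3 → Fin 3 → R) (l : List (Fin N))
    (x : ℂ) : Matrix (Fin 3) (Fin 3) R :=
  (l.map fun n => dualLax η (x - ξ n) (e n)).prod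

variable {η : ℂ} {ξ : Fin N → ℂ} {e : Fin N → Fin 3 → Fin 3 → R}

theorem entriesCommute_laxProd {l : List (Fin N)} {x : ℂ} {Y : Matrix (Fin 3) (Fin 3) R}
    (h : ∀ n ∈ l, EntriesCommute (Matrix.of (e n)) Y) :
    EntriesCommute (laxProd η ξ e l x) Y := by
  refine entriesCommute_list_prod_left fun X hX => ?_
  obtain ⟨n, hn, rfl⟩ := List.mem_map.1 hX
  exact entriesCommute_lax (h n hn)

theorem entriesCommute_dualLaxProd {l : List (Fin N)} {x : ℂ} {Y : Matrix (Fin 3) (Fin 3) R}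
    (h : ∀ n ∈ l, EntriesCommute (Matrix.of (e n)) Y) :
    EntriesCommute (dualLaxProd η ξ e l x) Y := by
  refine entriesCommute_list_prod_left fun X hX => ?_
  obtain ⟨n, hn, rfl⟩ := List.mem_map.1 hX
  exact entriesCommute_dualLax (h n hn)

namespace IsSiteUnits

theorem units_laxProd (he : IsSiteUnits e) {l : List (Fin N)} {n : Fin N} (hn : n ∉ l) (x : ℂ) :
    EntriesCommute (Matrix.of (e n)) (laxProd η ξ e l x) :=
  (entriesCommute_laxProd fun m hm => he.commute m n fun h => hn (h ▸ hm)).symm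

theorem units_dualLaxProd (he : IsSiteUnits e) {l : List (Fin N)} {n : Fin N} (hn : n ∉ l)
    (x : ℂ) : EntriesCommute (Matrix.of (e n)) (dualLaxProd η ξ e l x) :=
  (entriesCommute_dualLaxProd fun m hm => he.commute m n fun h => hn (h ▸ hm)).symm

theorem exchange_laxProd (he : IsSiteUnits e) {l : List (Fin N)} (hl : l.Nodup) (x y : ℂ) :
    Exchange η (x - y) (laxProd η ξ e l x) (laxProd η ξ e l y) := by
  induction l with
  | nil => simpa [laxProd, scalarMat_one] using exchange_scalarMat (R := R) η (x - y) 1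
  | cons n l ih =>
    obtain ⟨hn, hl⟩ := List.nodup_cons.1 hl
    have h := exchange_lax η (x - ξ n) (y - ξ n) (he.units n)
    rw [sub_sub_sub_cancel_right] at h
    exact h.mul (ih hl) (entriesCommute_lax (he.units_laxProd hn x)).symm
      (entriesCommute_lax (he.units_laxProd hn y)).symm

theorem exchange_monodromy (he : IsSiteUnits e) (K : Matrix (Fin 3) (Fin 3) ℂ)
    {l : List (Fin N)} (hl : l.Nodup) (x y : ℂ) :
    Exchange η (x - y) (scalarMat K * laxProd η ξ e l x) (scalarMat K * laxProd η ξ e l y) :=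
  (exchange_scalarMat η (x - y) K).mul (he.exchange_laxProd hl x y)
    (scalarMat_entriesCommute K _).symm (scalarMat_entriesCommute K _).symm

theorem fuses_laxProd (he : IsSiteUnits e) {l : List (Fin N)} (hl : l.Nodup) (x : ℂ) :
    Fuses (laxProd η ξ e l x) (laxProd η ξ e l (x - η))
      ((l.map fun n => x - η - ξ n).prod • dualLaxProd η ξ e l x) := by
  induction l with
  | nil =>
    have h := fuses_scalarMat (R := R) 1
    rw [Matrix.adjugate_one, Matrix.transpose_one, scalarMat_one] at h
    simpa [laxProd, dualLaxProd] using h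
  | cons n l ih =>
    obtain ⟨hn, hl⟩ := List.nodup_cons.1 hl
    have h := (fuses_lax η (x - ξ n) (he.units n) (he.sum_diag n)).mul
      (Y' := laxProd η ξ e l (x - η)) (ih hl)
      (entriesCommute_lax (he.units_laxProd hn x)).symm
    rw [smul_mul_smul_comm, sub_right_comm] at h
    simpa only [laxProd, dualLaxProd, List.map_cons, List.prod_cons] using h

theorem crossInverse_laxProd (he : IsSiteUnits e) {l : List (Fin N)} (hl : l.Nodup) (x : ℂ) :
    CrossInverse (l.map fun n => (x - ξ n) ^ 2 - η ^ 2).prod (laxProd η ξ e l x)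
      (dualLaxProd η ξ e l (x - η)) := by
  induction l with
  | nil =>
    have h := crossInverse_scalarMat (R := R) 1
    rw [Matrix.adjugate_one, Matrix.transpose_one, scalarMat_one] at h
    simpa [laxProd, dualLaxProd] using h
  | cons n l ih =>
    obtain ⟨hn, hl⟩ := List.nodup_cons.1 hl
    have h := (crossInverse_lax η (x - ξ n) (he.units n) (he.sum_diag n)).mul (ih hl)
      (entriesCommute_dualLax (he.units_laxProd hn x)).symm
    rw [sub_right_comm] at h
    simpa only [laxProd, dualLaxProd, List.map_cons, List.prod_cons] using h

end IsSiteUnits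

variable (η ξ e)

/-- The monodromy matrix with twist `K` over a list of sites. -/
abbrev chainMonodromy (K : Matrix (Fin 3) (Fin 3) ℂ) (l : List (Fin N)) (x : ℂ) :
    Matrix (Fin 3) (Fin 3) R :=
  scalarMat K * laxProd η ξ e l x

/-- The transfer matrix with twist `K` over a list of sites. -/
def transfer (K : Matrix (Fin 3) (Fin 3) ℂ) (l : List (Fin N)) (x : ℂ) : R :=
  (chainMonodromy η ξ e K l x).trace

/-- The transfer matrix with dual auxiliary space over a list of sites. -/
def dualTransfer (K : Matrix (Fin 3) (Fin 3) ℂ) (l : List (Fin N)) (x : ℂ) : R :=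
  (scalarMat K.adjugate.transpose * dualLaxProd η ξ e l x).trace

/-- The fused transfer matrix over a list of sites. -/
def fusedTransfer (K : Matrix (Fin 3) (Fin 3) ℂ) (l : List (Fin N)) (x : ℂ) : R :=
  (2 : ℂ)⁻¹ • (transfer η ξ e K l x * transfer η ξ e K l (x - η) -
    ∑ i, ∑ k, chainMonodromy η ξ e K l x k i * chainMonodromy η ξ e K l (x - η) i k)

variable {η ξ e}

namespace IsSiteUnits

theorem commute_transfer (he : IsSiteUnits e) (K : Matrix (Fin 3) (Fin 3) ℂ)
    {l : List (Fin N)} (hl : l.Nodup) {x y : ℂ} (hxy : (x - y) ^ 2 ≠ η ^ 2) :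
    Commute (transfer η ξ e K l x) (transfer η ξ e K l y) :=
  (he.exchange_monodromy K hl x y).commute_trace hxy

theorem fusedTransfer_eq (he : IsSiteUnits e) (K : Matrix (Fin 3) (Fin 3) ℂ)
    {l : List (Fin N)} (hl : l.Nodup) (x : ℂ) :
    fusedTransfer η ξ e K l x =
      (l.map fun n => x - η - ξ n).prod • dualTransfer η ξ e K l x := by
  have h := ((fuses_scalarMat K).mul (he.fuses_laxProd (η := η) (ξ := ξ) hl x)
    (scalarMat_entriesCommute K _).symm).trace_eq
  rw [fusedTransfer, transfer, transfer, h, smul_smul, inv_mul_cancel₀ two_ne_zero, one_smul,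
    Matrix.mul_smul, Matrix.trace_smul, dualTransfer]

theorem transfer_mul_transfer (he : IsSiteUnits e) (hη : η ≠ 0) (K : Matrix (Fin 3) (Fin 3) ℂ)
    {l : List (Fin N)} (hl : l.Nodup) {n : Fin N} (hn : n ∈ l) :
    transfer η ξ e K l (ξ n) * transfer η ξ e K l (ξ n - η) = fusedTransfer η ξ e K l (ξ n) := by
  obtain ⟨l₁, l₂, rfl⟩ := List.append_of_mem hn
  obtain ⟨-, hl₂, hd⟩ := List.nodup_append'.1 hl
  have hs : ∀ x, scalarMat K * laxProd η ξ e (l₁ ++ n :: l₂) x =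
      (scalarMat K * laxProd η ξ e l₁ x) * (lax η (x - ξ n) (e n) * laxProd η ξ e l₂ x) := by
    intro x
    simp [laxProd, mul_assoc]
  have hl₁ : l₁.Nodup := (List.nodup_append'.1 hl).1
  have hn₂ : n ∉ l₂ := (List.nodup_cons.1 hl₂).1
  have h₁ := he.exchange_monodromy (η := η) (ξ := ξ) K hl₁ (ξ n) (ξ n - η)
  rw [sub_sub_cancel] at h₁
  have hz : ∀ i k j m, symEntry (scalarMat K * laxProd η ξ e (l₁ ++ n :: l₂) (ξ n))
      (scalarMat K * laxProd η ξ e (l₁ ++ n :: l₂) (ξ n - η)) i k j m = 0 := by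
    intro i k j m
    rw [hs, hs]
    refine symEntry_mul_eq_zero_of_symm ?_ (h₁.symEntry_comm hη) ?_ i k j m
    · refine ((scalarMat_entriesCommute K _).mul_left ?_).symm
      refine entriesCommute_laxProd fun a ha => ?_
      have han : a ≠ n := fun h => List.disjoint_left.1 hd ha (h ▸ List.mem_cons_self ..)
      exact (entriesCommute_lax (he.commute n a han.symm)).symm.mul_right (he.units_laxProd
        (fun h => List.disjoint_left.1 hd ha (List.mem_cons_of_mem _ h)) _)
    · refine symEntry_mul_eq_zero (entriesCommute_lax (he.units_laxProd hn₂ _)).symm ?_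
      rw [sub_self, sub_right_comm, sub_self]
      exact symEntry_lax_zero η (he.units n)
  have h2 : transfer η ξ e K (l₁ ++ n :: l₂) (ξ n) * transfer η ξ e K (l₁ ++ n :: l₂) (ξ n - η) =
      -∑ i, ∑ k, chainMonodromy η ξ e K (l₁ ++ n :: l₂) (ξ n) k i *
        chainMonodromy η ξ e K (l₁ ++ n :: l₂) (ξ n - η) i k := by
    rw [eq_neg_iff_add_eq_zero]
    simp only [transfer, Matrix.trace, Matrix.diag, sum_mul_sum, ← sum_add_distrib]
    exact sum_eq_zero fun i _ => sum_eq_zero fun k _ => hz i k i k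
  rw [fusedTransfer, sub_eq_add_neg (transfer η ξ e K _ _ * _), ← h2, ← two_smul ℂ, smul_smul,
    inv_mul_cancel₀ two_ne_zero, one_smul]

theorem transfer_mul_dualTransfer (he : IsSiteUnits e) (K : Matrix (Fin 3) (Fin 3) ℂ)
    {l : List (Fin N)} (hl : l.Nodup) {n : Fin N} (hn : n ∈ l) :
    ∃ q : ℂ, transfer η ξ e K l (ξ n) * dualTransfer η ξ e K l (ξ n - η) = algebraMap ℂ R q := by
  obtain ⟨l₁, l₂, rfl⟩ := List.append_of_mem hn
  obtain ⟨hl₁, hl₂, hd⟩ := List.nodup_append'.1 hl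
  have hn₁ : n ∉ l₁ := fun h => List.disjoint_left.1 hd h (List.mem_cons_self ..)
  obtain ⟨hn₂, hl₂⟩ := List.nodup_cons.1 hl₂
  have hs : scalarMat K * laxProd η ξ e (l₁ ++ n :: l₂) (ξ n) =
      (scalarMat K * laxProd η ξ e l₁ (ξ n)) * lax η 0 (e n) * laxProd η ξ e l₂ (ξ n) := by
    simp [laxProd, mul_assoc]
  have hs' : scalarMat K.adjugate.transpose * dualLaxProd η ξ e (l₁ ++ n :: l₂) (ξ n - η) =
      (scalarMat K.adjugate.transpose * dualLaxProd η ξ e l₁ (ξ n - η)) *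
        dualLax η (0 - η) (e n) * dualLaxProd η ξ e l₂ (ξ n - η) := by
    simp [dualLaxProd, mul_assoc]
  rw [transfer, dualTransfer, chainMonodromy, hs, hs']
  refine ⟨_, trace_mul_trace_dual (he.units n) (he.sum_diag n)
    ((crossInverse_scalarMat K).mul (he.crossInverse_laxProd hl₁ (ξ n))
      (scalarMat_entriesCommute _ _).symm)
    (he.crossInverse_laxProd hl₂ (ξ n)) ?_ ?_ ?_ ?_⟩
  · refine (scalarMat_entriesCommute _ _).symm.mul_right ?_
    refine entriesCommute_laxProd fun m hm => he.units_dualLaxProd (fun h => ?_) _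
    exact List.disjoint_left.1 hd h (List.mem_cons_of_mem _ hm)
  · exact ((scalarMat_entriesCommute _ _).mul_left (he.units_dualLaxProd hn₁ _).symm :
      EntriesCommute _ (Matrix.of (e n)))
  · exact (he.units_laxProd hn₂ _).symm
  · exact (he.units_dualLaxProd hn₂ _).symm

end IsSiteUnits

/-- The linear functional `M ↦ tr (C M)`. -/
def traceMulLeft (C : Matrix (Fin 3) (Fin 3) R) : Matrix (Fin 3) (Fin 3) R →ₗ[ℂ] R :=
  (Matrix.traceLinearMap (Fin 3) ℂ R).comp (LinearMap.mulLeft ℂ C)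

theorem traceMulLeft_scalarMat_one (K : Matrix (Fin 3) (Fin 3) ℂ) :
    traceMulLeft (scalarMat K : Matrix (Fin 3) (Fin 3) R) 1 = algebraMap ℂ R K.trace := by
  simp [traceMulLeft, scalarMat, Matrix.trace]

theorem isPolyWithLead_transfer (K : Matrix (Fin 3) (Fin 3) ℂ) (l : List (Fin N)) :
    IsPolyWithLead l.length (algebraMap ℂ R K.trace) (transfer η ξ e K l) := by
  have h := (isPolyWithLead_list_prod (l.map fun n =>
    (-ξ n) • (1 : Matrix (Fin 3) (Fin 3) R) + η • Matrix.of fun i j => e n j i)).map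
      (traceMulLeft (scalarMat K))
  rw [traceMulLeft_scalarMat_one, List.length_map] at h
  convert h using 2 with x
  simp only [transfer, chainMonodromy, traceMulLeft, laxProd, LinearMap.comp_apply,
    LinearMap.mulLeft_apply, Matrix.traceLinearMap_apply, List.map_map]
  congr! 4
  funext n
  simp only [lax, Function.comp_apply]
  module

theorem isPolyWithLead_dualTransfer (K : Matrix (Fin 3) (Fin 3) ℂ) (l : List (Fin N)) :
    IsPolyWithLead l.length (algebraMap ℂ R K.adjugate.trace) (dualTransfer η ξ e K l) := by
  have h := (isPolyWithLead_list_prod (l.map fun n =>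
    (η - ξ n) • (1 : Matrix (Fin 3) (Fin 3) R) - η • Matrix.of (e n))).map
      (traceMulLeft (scalarMat K.adjugate.transpose))
  rw [traceMulLeft_scalarMat_one, List.length_map, Matrix.trace_transpose] at h
  convert h using 2 with x
  simp only [dualTransfer, traceMulLeft, dualLaxProd, LinearMap.comp_apply,
    LinearMap.mulLeft_apply, Matrix.traceLinearMap_apply, List.map_map]
  congr! 4
  funext n
  simp only [dualLax, Function.comp_apply]
  module

end Chain

section Bridge

/-- The matrix unit `E_{ij}` acting on site `n` of the chain. -/
def siteUnit (n : Fin N) (i j : Fin 3) : Op N :=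
  Matrix.of fun f g => if g n = j ∧ f = Function.update g n i then 1 else 0

theorem siteUnit_apply (n : Fin N) (i j : Fin 3) (f g : St N) :
    siteUnit n i j f g = if g n = j then if f = Function.update g n i then 1 else 0 else 0 := by
  rw [siteUnit, Matrix.of_apply, ite_and]

theorem siteUnit_mul_apply (n m : Fin N) (i j k l : Fin 3) (f g : St N) :
    (siteUnit n i j * siteUnit m k l) f g =
      if g m = l then siteUnit n i j f (Function.update g m k) else 0 := by
  rw [Matrix.mul_apply]
  simp only [siteUnit_apply m]
  split_ifs with h
  · simp
  · simp

theorem isSiteUnits_siteUnit : IsSiteUnits (siteUnit : Fin N → Fin 3 → Fin 3 → Op N) where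
  units n i j k l := by
    ext f g
    rw [siteUnit_mul_apply, siteUnit_apply]
    by_cases h : j = k
    · subst h; simp [siteUnit_apply]
    · simp [h, Ne.symm h]
  sum_diag n := by
    ext f g
    simp [Matrix.sum_apply, siteUnit_apply, Matrix.one_apply]
  commute n m hnm i j k l := by
    change siteUnit n i j * siteUnit m k l = siteUnit m k l * siteUnit n i j
    ext f g
    rw [siteUnit_mul_apply, siteUnit_mul_apply, siteUnit_apply, siteUnit_apply,
      Function.update_of_ne hnm, Function.update_of_ne hnm.symm, Function.update_comm hnm]
    split_ifs <;> rfl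

/-- Operators on auxiliary space tensor `H`, as matrices with entries acting on `H`. -/
def blocks : Matrix (Fin 3 × St N) (Fin 3 × St N) ℂ ≃+* Matrix (Fin 3) (Fin 3) (Op N) :=
  (Matrix.compRingEquiv (Fin 3) (St N) ℂ).symm

theorem blocks_apply (M : Matrix (Fin 3 × St N) (Fin 3 × St N) ℂ) (i j : Fin 3) (f g : St N) :
    blocks M i j f g = M (i, f) (j, g) := rfl

theorem blocks_Kaux (K : Matrix (Fin 3) (Fin 3) ℂ) :
    blocks (Kaux K : Matrix (Fin 3 × St N) (Fin 3 × St N) ℂ) = scalarMat K := by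
  ext i j f g
  simp [blocks_apply, Kaux, scalarMat, Matrix.algebraMap_matrix_apply]

theorem blocks_Raux (η : ℂ) (ξ : Fin N → ℂ) (x : ℂ) (n : Fin N) :
    blocks (Raux η ξ x n) = lax η (x - ξ n) (siteUnit n) := by
  ext i j f g
  simp only [blocks_apply, lax, Matrix.add_apply, Matrix.smul_apply, Matrix.of_apply, siteUnit,
    Raux, Matrix.one_apply, smul_eq_mul, Prod.mk.injEq, ite_and, eq_comm (a := g n)]
  by_cases h : i = j <;> simp [h, Matrix.one_apply]

/-- The order in which the sites appear in the monodromy matrix. -/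
def sites (N : ℕ) : List (Fin N) := (List.finRange N).reverse

theorem nodup_sites : (sites N).Nodup := List.nodup_reverse.2 (List.nodup_finRange N)

theorem mem_sites (n : Fin N) : n ∈ sites N := by simp [sites]

theorem length_sites : (sites N).length = N := by simp [sites]

theorem prod_map_sites (f : Fin N → ℂ) : ((sites N).map f).prod = ∏ n, f n := by
  rw [sites, List.map_reverse, List.prod_reverse, ← List.ofFn_eq_map, List.prod_ofFn]

variable (η : ℂ) (ξ : Fin N → ℂ) (K : Matrix (Fin 3) (Fin 3) ℂ) (x : ℂ)

theorem blocks_monodromy :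
    blocks (monodromy η ξ K x) = chainMonodromy η ξ siteUnit K (sites N) x := by
  rw [monodromy, map_mul, blocks_Kaux, map_list_prod, chainMonodromy, laxProd, sites,
    List.ofFn_eq_map, ← List.map_reverse, List.map_map]
  congr! 3
  funext n
  exact blocks_Raux η ξ x n

theorem T1_eq_transfer : T1 η ξ K x = transfer η ξ siteUnit K (sites N) x := by
  rw [transfer, ← blocks_monodromy]
  ext f g
  simp [T1, Matrix.trace, Matrix.sum_apply, blocks_apply]

theorem antisym2_mul_apply
    (M : Matrix ((Fin 3 × Fin 3) × St N) ((Fin 3 × Fin 3) × St N) ℂ) (i k : Fin 3) (f : St N)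
    (q : (Fin 3 × Fin 3) × St N) :
    (antisym2 * M : Matrix ((Fin 3 × Fin 3) × St N) ((Fin 3 × Fin 3) × St N) ℂ) ((i, k), f) q =
      2⁻¹ * (M ((i, k), f) q - M ((k, i), f) q) := by
  rw [Matrix.mul_apply, Fintype.sum_prod_type_right, sum_eq_single f, mul_sub]
  · have h : ∀ p : Fin 3 × Fin 3, antisym2 ((i, k), f) (p, f) * M (p, f) q =
        (if p = (i, k) then 2⁻¹ * M (p, f) q else 0) -
          if p = (k, i) then 2⁻¹ * M (p, f) q else 0 := by
      rintro ⟨a, b⟩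
      simp only [antisym2, Matrix.of_apply, if_true, one_mul, mul_sub, sub_mul, Prod.mk.injEq]
      congr 1 <;> simp [eq_comm, and_comm]
    simp [h, sum_sub_distrib]
  · intro g _ hg
    simp [antisym2, hg.symm]
  · simp

theorem emb1_mul_emb2_apply (X Y : Matrix (Fin 3 × St N) (Fin 3 × St N) ℂ) (i k j l : Fin 3)
    (f g : St N) :
    (emb1 X * emb2 Y) ((i, k), f) ((j, l), g) = (blocks X i j * blocks Y k l) f g := by
  rw [Matrix.mul_apply, Matrix.mul_apply, Fintype.sum_prod_type, Fintype.sum_prod_type]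
  simp [emb1, emb2, blocks_apply]

theorem T2_eq_fusedTransfer : T2 η ξ K x = fusedTransfer η ξ siteUnit K (sites N) x := by
  rw [fusedTransfer, transfer, transfer, ← blocks_monodromy, ← blocks_monodromy]
  ext f g
  simp only [T2, Matrix.of_apply, mul_assoc, Fintype.sum_prod_type, antisym2_mul_apply,
    emb1_mul_emb2_apply, Matrix.trace, Matrix.diag, sum_mul, mul_sum, Matrix.smul_apply,
    Matrix.sub_apply, Matrix.sum_apply, smul_eq_mul, mul_sub,
    sum_sub_distrib]
  rw [sum_comm]

/-- The reduced fused transfer matrix `T₂(x) / d(x - η)`. -/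
def reducedT2 : Op N := dualTransfer η ξ siteUnit K (sites N) x

theorem T2_eq_smul : T2 η ξ K x = dfun ξ (x - η) • reducedT2 η ξ K x := by
  rw [T2_eq_fusedTransfer, isSiteUnits_siteUnit.fusedTransfer_eq K nodup_sites, prod_map_sites]
  rfl

theorem isPolyWithLead_T1 : IsPolyWithLead N (algebraMap ℂ (Op N) K.trace) (T1 η ξ K) := by
  have h := isPolyWithLead_transfer (η := η) (ξ := ξ) (e := siteUnit) K (sites N)
  rw [length_sites] at h
  rwa [show T1 η ξ K = _ from funext (T1_eq_transfer η ξ K)]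

theorem isPolyWithLead_reducedT2 :
    IsPolyWithLead N (algebraMap ℂ (Op N) K.adjugate.trace) (reducedT2 η ξ K) := by
  have h := isPolyWithLead_dualTransfer (η := η) (ξ := ξ) (e := siteUnit) K (sites N)
  rwa [length_sites] at h

variable {η ξ}

theorem T1_mul_T1 (hη : η ≠ 0) (n : Fin N) :
    T1 η ξ K (ξ n) * T1 η ξ K (ξ n - η) = dfun ξ (ξ n - η) • reducedT2 η ξ K (ξ n) := by
  rw [← T2_eq_smul, T1_eq_transfer, T1_eq_transfer, T2_eq_fusedTransfer]
  exact isSiteUnits_siteUnit.transfer_mul_transfer hη K nodup_sites (mem_sites n)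

theorem T1_mul_reducedT2 (n : Fin N) :
    ∃ q : ℂ, T1 η ξ K (ξ n) * reducedT2 η ξ K (ξ n - η) = algebraMap ℂ (Op N) q := by
  rw [T1_eq_transfer]
  exact isSiteUnits_siteUnit.transfer_mul_dualTransfer K nodup_sites (mem_sites n)

theorem commute_T1 (hξ : InhomCond η ξ) (i j : Fin N) :
    Commute (T1 η ξ K (ξ i)) (T1 η ξ K (ξ j)) := by
  by_cases h : i = j
  · rw [h]
  · rw [T1_eq_transfer, T1_eq_transfer]
    refine isSiteUnits_siteUnit.commute_transfer K nodup_sites fun h' => ?_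
    rcases sq_eq_sq_iff_eq_or_eq_neg.1 h' with h' | h'
    · exact (hξ i j h).2.1 h'
    · exact (hξ i j h).2.2 h'

end Bridge

theorem IsPolyWithLead.interpolation_fin {V : Type*} [AddCommGroup V] [Module ℂ V] {c : V}
    {F : ℂ → V} (hF : IsPolyWithLead N c F) {p : Fin N → ℂ} (hp : Function.Injective p) (x : ℂ) :
    F x = (∏ m, (x - p m)) • c + ∑ m, lagr p x m • F (p m) := by
  refine IsPolyWithLead.interpolation ?_ hp x
  rwa [Fintype.card_fin]

theorem IsPolyWithLead.mem_subalgebra {R : Type*} [Ring R] [Algebra ℂ R] {S : Subalgebra ℂ R}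
    {c : ℂ} {F : ℂ → R} (hF : IsPolyWithLead N (algebraMap ℂ R c) F) {p : Fin N → ℂ}
    (hp : Function.Injective p) (h : ∀ n, F (p n) ∈ S) (x : ℂ) : F x ∈ S := by
  rw [hF.interpolation_fin hp x]
  exact add_mem (S.smul_mem (S.algebraMap_mem c) _) (sum_mem fun m _ => S.smul_mem (h m) _)

theorem IsPolyWithLead.codRestrict {R : Type*} [Ring R] [Algebra ℂ R] {S : Subalgebra ℂ R}
    {n : ℕ} {c : ℂ} {F : ℂ → R} (hF : IsPolyWithLead n (algebraMap ℂ R c) F) (h : ∀ x, F x ∈ S) :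
    IsPolyWithLead n (algebraMap ℂ S c) fun x => (⟨F x, h x⟩ : S) := by
  obtain ⟨g, hg⟩ := S.val.toLinearMap.exists_leftInverse_of_injective
    (LinearMap.ker_eq_bot.2 Subtype.val_injective)
  have hg' : ∀ s : S, g s = s := fun s => LinearMap.congr_fun hg s
  have h1 := hF.map g
  rw [show algebraMap ℂ R c = (algebraMap ℂ S c : S) from rfl, hg'] at h1
  rwa [show (fun x => g (F x)) = _ from funext fun x => hg' ⟨F x, h x⟩] at h1

theorem InhomCond.injective {η : ℂ} {ξ : Fin N → ℂ} (hξ : InhomCond η ξ) :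
    Function.Injective ξ := fun i j hij => by
  by_contra hne
  exact (hξ i j hne).1 (sub_eq_zero.2 hij)

open scoped IsMulCommutative in
theorem exists_fusionSystem {η : ℂ} (hη : η ≠ 0) {ξ : Fin N → ℂ} (hξ : InhomCond η ξ)
    (K : Matrix (Fin 3) (Fin 3) ℂ) :
    ∃ (A : Type) (_ : CommRing A) (_ : Algebra ℂ A) (f : A →ₐ[ℂ] Op N) (T t : ℂ → A),
      FusionSystem η ξ T t ∧ (∀ x, f (T x) = T1 η ξ K x) ∧ ∀ x, f (t x) = reducedT2 η ξ K x := by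
  set S := Algebra.adjoin ℂ (Set.range fun n => T1 η ξ K (ξ n)) with hS
  have hcomm : ∀ a ∈ Set.range fun n => T1 η ξ K (ξ n), ∀ b ∈ Set.range fun n => T1 η ξ K (ξ n),
      a * b = b * a := by
    rintro _ ⟨i, rfl⟩ _ ⟨j, rfl⟩
    exact commute_T1 K hξ i j
  have hT : ∀ x, T1 η ξ K x ∈ S :=
    (isPolyWithLead_T1 η ξ K).mem_subalgebra hξ.injective fun n =>
      Algebra.subset_adjoin ⟨n, rfl⟩
  have ht : ∀ x, reducedT2 η ξ K x ∈ S := by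
    refine (isPolyWithLead_reducedT2 η ξ K).mem_subalgebra hξ.injective fun n => ?_
    have h := S.smul_mem (S.mul_mem (hT (ξ n)) (hT (ξ n - η))) (dfun ξ (ξ n - η))⁻¹
    rwa [T1_mul_T1 K hη, inv_smul_smul₀ (dfun_sub_ne_zero hη hξ n)] at h
  have := Algebra.isMulCommutative_adjoin ℂ hcomm
  let _ : CommRing S := inferInstance
  refine ⟨S, inferInstance, inferInstance, S.val, fun x => ⟨_, hT x⟩, fun x => ⟨_, ht x⟩, ?_,
    fun _ => rfl, fun _ => rfl⟩
  exact
    { poly_T := ⟨_, (isPolyWithLead_T1 η ξ K).codRestrict hT⟩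
      poly_t := ⟨_, (isPolyWithLead_reducedT2 η ξ K).codRestrict ht⟩
      fusion := fun n => Subtype.ext (T1_mul_T1 K hη n)
      qdet := fun n => (T1_mul_reducedT2 K n).imp fun q hq => Subtype.ext hq }

section Couplings

theorem exists_vdm_update (p : Fin N → ℂ) (a : Fin N) :
    ∃ C : ℂ, ∀ y, Vdm (Function.update p a y) = C * ∏ m ∈ univ.erase a, (y - p m) := by
  refine ⟨(∏ j ∈ univ.erase a, (if a < j then -1 else 1)) *
    ∏ j ∈ univ.erase a, ∏ i ∈ (univ.filter fun i => i < j).erase a, (p j - p i), fun y => ?_⟩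
  have h1 : ∏ i ∈ univ.filter (fun i => i < a),
      (Function.update p a y a - Function.update p a y i) =
      ∏ i ∈ univ.erase a, if i < a then y - p i else 1 := by
    rw [prod_filter, ← mul_prod_erase univ _ (mem_univ a), if_neg (lt_irrefl a), one_mul]
    refine prod_congr rfl fun i hi => ?_
    rw [Function.update_self, Function.update_of_ne (ne_of_mem_erase hi)]
  have h2 : ∀ j ∈ univ.erase a, ∏ i ∈ univ.filter (fun i => i < j),
      (Function.update p a y j - Function.update p a y i) =
      (if a < j then p j - y else 1) *
        ∏ i ∈ (univ.filter fun i => i < j).erase a, (p j - p i) := by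
    intro j hj
    rw [Function.update_of_ne (ne_of_mem_erase hj)]
    have h3 : ∏ i ∈ (univ.filter fun i => i < j).erase a, (p j - Function.update p a y i) =
        ∏ i ∈ (univ.filter fun i => i < j).erase a, (p j - p i) :=
      prod_congr rfl fun i hi => by rw [Function.update_of_ne (ne_of_mem_erase hi)]
    rw [← h3]
    split_ifs with h
    · rw [← mul_prod_erase (univ.filter fun i => i < j) _ (mem_filter.2 ⟨mem_univ a, h⟩),
        Function.update_self]
    · rw [one_mul, erase_eq_of_notMem (s := univ.filter fun i => i < j) (a := a)
        (fun h' => h (mem_filter.1 h').2)]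
  have h4 : (∏ i ∈ univ.erase a, if i < a then y - p i else 1) *
      (∏ j ∈ univ.erase a, if a < j then p j - y else 1) =
      (∏ j ∈ univ.erase a, (if a < j then -1 else 1)) * ∏ m ∈ univ.erase a, (y - p m) := by
    rw [← prod_mul_distrib, ← prod_mul_distrib]
    refine prod_congr rfl fun m hm => ?_
    rcases lt_or_gt_of_ne (ne_of_mem_erase hm) with h | h
    · simp [h, h.not_gt]
    · simp [h, h.not_gt]
  rw [Vdm, ← mul_prod_erase univ _ (mem_univ a), h1, prod_congr rfl h2, prod_mul_distrib,
    ← mul_assoc, h4, mul_right_comm]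

theorem vdm_update {p : Fin N → ℂ} (hp : Function.Injective p) (a : Fin N) (y : ℂ) :
    Vdm (Function.update p a y) = lagr p y a * Vdm p := by
  obtain ⟨C, hC⟩ := exists_vdm_update p a
  have h := hC (p a)
  rw [Function.update_eq_self] at h
  rw [hC, h, lagr, prod_div_distrib]
  have h0 : ∏ m ∈ univ.erase a, (p a - p m) ≠ 0 :=
    prod_ne_zero_iff.2 fun m hm => sub_ne_zero.2 fun h' => ne_of_mem_erase hm (hp h').symm
  field_simp

theorem vdm_ne_zero {p : Fin N → ℂ} (hp : Function.Injective p) : Vdm p ≠ 0 :=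
  prod_ne_zero_iff.2 fun _ _ => prod_ne_zero_iff.2 fun _ hi =>
    sub_ne_zero.2 fun h => (mem_filter.1 hi).2.ne' (hp h)

variable {η : ℂ} {ξ : Fin N → ℂ}

theorem prod_update_mul {ι M : Type*} [Fintype ι] [DecidableEq ι] [CommMonoid M] {β : Type*}
    (F : ι → β → M) (h : ι → β) (a : ι) (b : β) :
    (∏ n, F n (h n)) * F a b = F a (h a) * ∏ n, F n (Function.update h a b n) := by
  rw [← mul_prod_erase univ _ (mem_univ a),
    ← mul_prod_erase univ (fun n => F n (Function.update h a b n)) (mem_univ a),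
    Function.update_self, mul_right_comm, mul_assoc]
  congr 2
  refine prod_congr rfl fun n hn => ?_
  rw [Function.update_of_ne (ne_of_mem_erase hn)]

/-- Positions of the interpolation points attached to a label. -/
def shifted (η : ℂ) (ξ : Fin N → ℂ) (h : St N) (n : Fin N) : ℂ :=
  ξ n - (if h n = 0 then 0 else 1) * η

theorem shifted_def (h : St N) :
    shifted η ξ h = fun n => ξ n - (if h n = 0 then 0 else 1) * η := rfl

theorem shifted_injective (hξ : InhomCond η ξ) (h : St N) : Function.Injective (shifted η ξ h) :=
  injective_sub_mul hξ fun n => h n = 0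

theorem shifted_update (h : St N) (a : Fin N) :
    shifted η ξ (Function.update h a 0) = Function.update (shifted η ξ h) a (ξ a) := by
  funext n
  by_cases hn : n = a
  · subst hn; simp [shifted]
  · simp [shifted, Function.update_of_ne hn]

/-- Positions of the second family of points attached to a label. -/
def shiftedTwo (η : ℂ) (ξ : Fin N → ℂ) (h : St N) (n : Fin N) : ℂ :=
  ξ n - (if h n = 2 then 1 else 0) * η

theorem shiftedTwo_injective (hξ : InhomCond η ξ) (h : St N) :
    Function.Injective (shiftedTwo η ξ h) := by
  convert injective_sub_mul hξ (fun n => h n ≠ 2) using 2 with n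
  by_cases hn : h n = 2 <;> simp [shiftedTwo, hn]

theorem shiftedTwo_eq_shifted {h : St N} (h1 : ∀ n, h n ≠ 1) :
    shiftedTwo η ξ h = shifted η ξ h := by
  funext n
  have := h1 n
  generalize hk : h n = k at this
  fin_cases k <;> simp_all [shifted, shiftedTwo]

theorem shiftedTwo_update {h : St N} {a : Fin N} (ha : h a = 1) :
    shiftedTwo η ξ (Function.update h a 0) = shiftedTwo η ξ h := by
  funext n
  by_cases hn : n = a
  · subst hn; simp [shiftedTwo, ha]
  · simp [shiftedTwo, Function.update_of_ne hn]

theorem Nh_eq (h : St N) : Nh η ξ h =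
    (∏ a, dfun ξ (ξ a - η) / dfun ξ (ξ a - ((1 : ℂ) + (if h a = 0 then 0 else 1)) * η)) *
      Vdm ξ ^ 2 / (Vdm (shifted η ξ h) * Vdm (shiftedTwo η ξ h)) := rfl

theorem lagr_shifted_ne_zero (hξ : InhomCond η ξ) (h : St N) (a : Fin N) :
    lagr (shifted η ξ h) (ξ a) a ≠ 0 := by
  have h0 := vdm_ne_zero (shifted_injective hξ (Function.update h a 0))
  rw [shifted_update, vdm_update (shifted_injective hξ h)] at h0
  exact left_ne_zero_of_mul h0

theorem Nh_update_aux (hη : η ≠ 0) (hξ : InhomCond η ξ) {h : St N} {a : Fin N} (ha : h a ≠ 0)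
    (hd : dfun ξ (ξ a - 2 * η) ≠ 0) {c : ℂ} (hc : c ≠ 0)
    (h2 : Vdm (shiftedTwo η ξ (Function.update h a 0)) = c * Vdm (shiftedTwo η ξ h)) :
    Nh η ξ h * dfun ξ (ξ a - 2 * η) = dfun ξ (ξ a - η) *
      (lagr (shifted η ξ h) (ξ a) a * c) * Nh η ξ (Function.update h a 0) := by
  have hp := prod_update_mul (fun (n : Fin N) (i : Fin 3) =>
    dfun ξ (ξ n - η) / dfun ξ (ξ n - ((1 : ℂ) + (if i = 0 then 0 else 1)) * η)) h a 0
  simp only [ha, if_true, if_false, add_zero, one_mul, div_self (dfun_sub_ne_zero hη hξ a),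
    mul_one, one_add_one_eq_two] at hp
  have hV := vdm_ne_zero (shifted_injective hξ h)
  have hV2 := vdm_ne_zero (shiftedTwo_injective hξ h)
  have hl := lagr_shifted_ne_zero hξ h a
  rw [Nh_eq, Nh_eq, hp, h2, shifted_update, vdm_update (shifted_injective hξ h)]
  generalize dfun ξ (ξ a - 2 * η) = D at *
  generalize dfun ξ (ξ a - η) = E at *
  generalize ∏ n, dfun ξ (ξ n - η) / dfun ξ (ξ n - (1 + if Function.update h a 0 n = 0
    then 0 else 1) * η) = Q at *
  field_simp

theorem Nh_update_of_eq_one (hη : η ≠ 0) (hξ : InhomCond η ξ) {h : St N} {a : Fin N}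
    (ha : h a = 1) (hd : dfun ξ (ξ a - 2 * η) ≠ 0) :
    Nh η ξ h * dfun ξ (ξ a - 2 * η) = dfun ξ (ξ a - η) * lagr (shifted η ξ h) (ξ a) a *
      Nh η ξ (Function.update h a 0) := by
  have := Nh_update_aux hη hξ (a := a) (h := h) (by simp [ha]) hd one_ne_zero
    (by rw [shiftedTwo_update ha, one_mul])
  rwa [mul_one] at this

theorem Nh_update_of_eq_two (hη : η ≠ 0) (hξ : InhomCond η ξ) {h : St N} {a : Fin N}
    (h1 : ∀ n, h n ≠ 1) (ha : h a = 2) (hd : dfun ξ (ξ a - 2 * η) ≠ 0) :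
    Nh η ξ h * dfun ξ (ξ a - 2 * η) = dfun ξ (ξ a - η) * lagr (shifted η ξ h) (ξ a) a ^ 2 *
      Nh η ξ (Function.update h a 0) := by
  rw [pow_two]
  refine Nh_update_aux hη hξ (by simp [ha]) hd (lagr_shifted_ne_zero hξ h a) ?_
  have h1' : ∀ n, Function.update h a 0 n ≠ 1 := by
    intro n
    by_cases hn : n = a
    · subst hn; simp
    · rw [Function.update_of_ne hn]; exact h1 n
  rw [shiftedTwo_eq_shifted h1, shiftedTwo_eq_shifted h1', shifted_update,
    vdm_update (shifted_injective hξ h)]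

theorem Nh_zeroSt (hη : η ≠ 0) (hξ : InhomCond η ξ) : Nh η ξ zeroSt = 1 := by
  have hV := vdm_ne_zero hξ.injective
  have hs : shifted η ξ zeroSt = ξ := by funext n; simp [shifted, zeroSt]
  have hs2 : shiftedTwo η ξ zeroSt = ξ := by funext n; simp [shiftedTwo, zeroSt]
  rw [Nh_eq, hs, hs2, prod_eq_one fun a _ => ?_, one_mul, ← pow_two, div_self (pow_ne_zero 2 hV)]
  simp [zeroSt, div_self (dfun_sub_ne_zero hη hξ a)]

theorem eq_Nh_of_recursion (hη : η ≠ 0) (hξ : InhomCond η ξ)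
    (hd : ∀ n, dfun ξ (ξ n - 2 * η) ≠ 0) {G : St N → ℂ} (h0 : G zeroSt = 1)
    (hG1 : ∀ h a, h a = 1 → G h * dfun ξ (ξ a - 2 * η) =
      dfun ξ (ξ a - η) * lagr (shifted η ξ h) (ξ a) a * G (Function.update h a 0))
    (hG2 : ∀ h a, (∀ n, h n ≠ 1) → h a = 2 → G h * dfun ξ (ξ a - 2 * η) =
      dfun ξ (ξ a - η) * lagr (shifted η ξ h) (ξ a) a ^ 2 * G (Function.update h a 0))
    (h : St N) : G h = Nh η ξ h := by
  induction hk : #{n | h n ≠ 0} using Nat.strong_induction_on generalizing h with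
  | _ k ih =>
    have hlt : ∀ a, h a ≠ 0 → #{n | Function.update h a 0 n ≠ 0} < k := by
      intro a ha
      rw [← hk]
      refine card_lt_card (ssubset_iff_of_subset ?_ |>.2 ⟨a, by simpa using ha, by simp⟩)
      intro n hn
      rw [mem_filter] at hn ⊢
      refine ⟨mem_univ n, ?_⟩
      by_cases hna : n = a
      · subst hna; exact ha
      · have := hn.2
        rwa [Function.update_of_ne hna] at this
    by_cases h1 : ∃ a, h a = 1
    · obtain ⟨a, ha⟩ := h1
      refine mul_right_cancel₀ (hd a) ?_
      rw [hG1 h a ha, Nh_update_of_eq_one hη hξ ha (hd a), ih _ (hlt a (by simp [ha])) _ rfl]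
    · push Not at h1
      by_cases h2 : ∃ a, h a = 2
      · obtain ⟨a, ha⟩ := h2
        refine mul_right_cancel₀ (hd a) ?_
        rw [hG2 h a h1 ha, Nh_update_of_eq_two hη hξ h1 ha (hd a),
          ih _ (hlt a (by simp [ha])) _ rfl]
      · push Not at h2
        have : h = zeroSt := by
          funext n
          have e1 := h1 n
          have e2 := h2 n
          change h n = 0
          generalize h n = j at *
          fin_cases j <;> simp_all
        rw [this, h0, Nh_zeroSt hη hξ]

end Couplings

section SoVMonomials

variable {A : Type*} [CommRing A] [Algebra ℂ A] {η : ℂ} {ξ : Fin N → ℂ} {T t : ℂ → A}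
  {K : Matrix (Fin 3) (Fin 3) ℂ} {f : A →ₐ[ℂ] Op N}

/-- Normalization of the SoV co-vectors at one site. -/
def covCoef (η : ℂ) (ξ : Fin N → ℂ) (n : Fin N) : Fin 3 → ℂ := ![dfun ξ (ξ n - 2 * η), 1, 1]

/-- Normalization of the SoV vectors at one site. -/
def vecCoef (η : ℂ) (ξ : Fin N → ℂ) (n : Fin N) : Fin 3 → ℂ := ![1, dfun ξ (ξ n - η), 1]

/-- Factor of the SoV vector monomials at one site. -/
def vecSite (ξ : Fin N → ℂ) (T t : ℂ → A) (n : Fin N) : Fin 3 → A := ![1, t (ξ n), T (ξ n)]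

theorem sovCovOp_eq (hT : ∀ x, f (T x) = T1 η ξ K x) (ht : ∀ x, f (t x) = reducedT2 η ξ K x)
    (k : St N) : sovCovOp η ξ K k = f ((∏ n, covCoef η ξ n (k n)) • covMon η ξ T t k) := by
  have h : ∀ n, T2 η ξ K (ξ n - η) ^ (if k n = 0 then 1 else 0) *
      T1 η ξ K (ξ n) ^ (if k n = 2 then 1 else 0) =
      f (covCoef η ξ n (k n) • covSite η ξ T t n (k n)) := by
    intro n
    generalize k n = i
    fin_cases i
    · simp [covCoef, covSite, T2_eq_smul, ht, sub_sub, two_mul]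
    · simp [covCoef, covSite]
    · simp [covCoef, covSite, hT]
  rw [sovCovOp, funext h, covMon, ← prod_smul, ← List.prod_ofFn, map_list_prod, List.map_ofFn]
  rfl

theorem sovVecOp_eq (hT : ∀ x, f (T x) = T1 η ξ K x) (ht : ∀ x, f (t x) = reducedT2 η ξ K x)
    (k : St N) :
    sovVecOp η ξ K k = f ((∏ n, vecCoef η ξ n (k n)) • ∏ n, vecSite ξ T t n (k n)) := by
  have h : ∀ n, T2 η ξ K (ξ n) ^ (if k n = 1 then 1 else 0) *
      T1 η ξ K (ξ n) ^ (if k n = 2 then 1 else 0) =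
      f (vecCoef η ξ n (k n) • vecSite ξ T t n (k n)) := by
    intro n
    generalize k n = i
    fin_cases i
    · simp [vecCoef, vecSite]
    · simp [vecCoef, vecSite, T2_eq_smul, ht]
    · simp [vecCoef, vecSite, hT]
  rw [sovVecOp, funext h, ← prod_smul, ← List.prod_ofFn, map_list_prod, List.map_ofFn]
  rfl

omit [Algebra ℂ A] in
theorem covMon_mul_prod_vecSite (h : St N) :
    covMon η ξ T t h * ∏ n, vecSite ξ T t n (h n) = diagMon η ξ T t h := by
  rw [covMon, diagMon, ← prod_mul_distrib]
  refine prod_congr rfl fun n _ => ?_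
  generalize h n = i
  fin_cases i
  · simp [covSite, vecSite, diagSite]
  · simp [covSite, vecSite, diagSite]
  · simp [covSite, vecSite, diagSite, sq]

omit [Algebra ℂ A] in
theorem covMon_zeroSt : covMon η ξ T t zeroSt = diagMon η ξ T t zeroSt := rfl

/-- The functional `a ↦ ⟨L|f(a)|R⟩`. -/
def matrixElement (f : A →ₐ[ℂ] Op N) (L R : Hsp N) : A →ₗ[ℂ] ℂ where
  toFun a := pair L (Matrix.mulVec (f a) R)
  map_add' a b := by
    rw [map_add, Matrix.add_mulVec]
    exact dotProduct_add L _ _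
  map_smul' c a := by
    rw [map_smul, Matrix.smul_mulVec]
    exact dotProduct_smul c L _

theorem pair_vecMul_mulVec (L R : Hsp N) (a b : A) :
    pair (Matrix.vecMul L (f a)) (Matrix.mulVec (f b) R) = matrixElement f L R (a * b) := by
  change Matrix.vecMul L (f a) ⬝ᵥ Matrix.mulVec (f b) R = L ⬝ᵥ Matrix.mulVec (f (a * b)) R
  rw [map_mul, ← Matrix.mulVec_mulVec, Matrix.dotProduct_mulVec L]

theorem pair_vecMul (L R : Hsp N) (a : A) :
    pair (Matrix.vecMul L (f a)) R = matrixElement f L R a := by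
  rw [← mul_one a, ← pair_vecMul_mulVec, map_one, Matrix.one_mulVec, mul_one]

theorem pair_sovCov_sovVec (hT : ∀ x, f (T x) = T1 η ξ K x)
    (ht : ∀ x, f (t x) = reducedT2 η ξ K x) (L R : Hsp N) (h : St N) :
    pair (sovCov η ξ K L h) (sovVec η ξ K R h) =
      (∏ n, covCoef η ξ n (h n) * vecCoef η ξ n (h n)) *
        matrixElement f L R (diagMon η ξ T t h) := by
  rw [sovCov, sovVec, sovCovOp_eq hT ht, sovVecOp_eq hT ht, pair_vecMul_mulVec, smul_mul_smul_comm,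
    covMon_mul_prod_vecSite, map_smul, smul_eq_mul, prod_mul_distrib]

theorem pair_sovCov (hT : ∀ x, f (T x) = T1 η ξ K x) (ht : ∀ x, f (t x) = reducedT2 η ξ K x)
    (L R : Hsp N) (k : St N) : pair (sovCov η ξ K L k) R =
      (∏ n, covCoef η ξ n (k n)) * matrixElement f L R (covMon η ξ T t k) := by
  rw [sovCov, sovCovOp_eq hT ht, pair_vecMul, map_smul, smul_eq_mul]

end SoVMonomials

end
end SoV

namespace SoV
noncomputable section

/-- the diagonal SoV couplings are given by `⟨h|h⟩ = N_h`. -/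
theorem statement_3 (N : ℕ) (η : ℂ) (hη : η ≠ 0) (ξ : Fin N → ℂ) (hξ : InhomCond η ξ)
    (K : Matrix (Fin 3) (Fin 3) ℂ) (hK : SimpleSpectrum K) (L R0 : Hsp N)
    (hbL : IsBasisFamily (sovCov η ξ K L))
    (hR0 : DualRef η ξ K L R0)
    (hbR : IsBasisFamily (sovVec η ξ K R0)) :
    ∀ h : St N, pair (sovCov η ξ K L h) (sovVec η ξ K R0 h) = Nh η ξ h := by
  obtain ⟨A, _, _, f, T, t, hS, hT, ht⟩ := exists_fusionSystem hη hξ K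
  have hcov := pair_sovCov hT ht L R0
  have hzero : (∏ n, covCoef η ξ n (zeroSt n)) *
      matrixElement f L R0 (covMon η ξ T t zeroSt) = 1 := by
    rw [← hcov, hR0, if_pos rfl]
  have hd : ∀ n, dfun ξ (ξ n - 2 * η) ≠ 0 := fun n =>
    Finset.prod_ne_zero_iff.1 (left_ne_zero_of_mul (hzero ▸ one_ne_zero)) n (Finset.mem_univ n)
  have hc : ∀ n i, covCoef η ξ n i ≠ 0 := by
    intro n i
    fin_cases i
    · exact hd n
    · exact one_ne_zero
    · exact one_ne_zero
  have hφ : ∀ k, k ≠ zeroSt → matrixElement f L R0 (covMon η ξ T t k) = 0 := by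
    intro k hk
    have h := hR0 k
    rw [if_neg hk, hcov] at h
    exact (mul_eq_zero.1 h).resolve_left (Finset.prod_ne_zero_iff.2 fun n _ => hc n (k n))
  have hupdate := fun h a => prod_update_mul
    (fun n i => covCoef η ξ n i * vecCoef η ξ n i) h a 0
  have hcoef : ∀ a, covCoef η ξ a 0 * vecCoef η ξ a 0 = dfun ξ (ξ a - 2 * η) ∧
      covCoef η ξ a 1 * vecCoef η ξ a 1 = dfun ξ (ξ a - η) ∧
      covCoef η ξ a 2 * vecCoef η ξ a 2 = 1 := fun a =>
    ⟨mul_one _, one_mul _, one_mul _⟩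
  refine eq_Nh_of_recursion hη hξ hd ?_ (fun h a ha => ?_) fun h a h1 ha => ?_
  · rw [pair_sovCov_sovVec hT ht, ← covMon_zeroSt, ← hzero]
    congr 1
    exact Finset.prod_congr rfl fun n _ => mul_one _
  · have e := hupdate h a
    simp only [ha, hcoef] at e
    rw [pair_sovCov_sovVec hT ht, pair_sovCov_sovVec hT ht,
      hS.map_diagMon_of_eq_one hη hξ hφ h a ha, shifted_def]
    linear_combination lagr (fun m => ξ m - (if h m = 0 then 0 else 1) * η) (ξ a) a *
      matrixElement f L R0 (diagMon η ξ T t (Function.update h a 0)) * e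
  · have e := hupdate h a
    simp only [ha, hcoef] at e
    rw [pair_sovCov_sovVec hT ht, pair_sovCov_sovVec hT ht,
      hS.map_diagMon_of_eq_two hη hξ hφ h h1 a ha, shifted_def]
    linear_combination dfun ξ (ξ a - η) *
      lagr (fun m => ξ m - (if h m = 0 then 0 else 1) * η) (ξ a) a ^ 2 *
      matrixElement f L R0 (diagMon η ξ T t (Function.update h a 0)) * e

end
end SoV
end

section
/- Let K be a 3×3 complex matrix with simple spectrum, with SoV covector and vector bases satisfying the pseudo-orthogonality relations ⟨h|k⟩ = ⟨k|k⟩(δ_{h,k} + C_h^k Σ_{r≥1} (det K)^r Σ_{α,β} δ_{h,k_{α,β}^{(0,2)}}). Let |h⟩_p be the unique vectors with ⟨k|h⟩_p = δ_{k,h}⟨h|h⟩ for all k. Then, with c = det K and C̄_s^r = (⟨r|r⟩/⟨s|s⟩)·C_s^r, each |h⟩_p admits the decomposition |h⟩_p = |h⟩ + Σ_{r=1}^{n_h} c^r Σ_{α∪β∪γ = 1_h, disjoint, #α=#β=r} B_{α,β,h} |h_{α,β}^{(0,2)}⟩, where the coefficients B_{α,β,h} are completely determined by the recursion B_{α,β,h}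 = −( C̄_{h_{α,β}^{(0,2)}}^{h} + Σ_{α'⊂α, β'⊂β, 1≤#α'=#β'≤#α−1} B_{α',β',h} · C̄_{h_{α,β}^{(0,2)}}^{h_{α',β'}^{(0,2)}} ). -/
open scoped BigOperators

namespace SoV
noncomputable section

/-- The pairs `(α, β)` of disjoint subsets of `1_h` of equal positive cardinality. -/
def balancedPairs (h : St N) : Finset (Finset (Fin N) × Finset (Fin N)) :=
  Finset.univ.filter fun p => p.1 ⊆ ones h ∧ p.2 ⊆ ones h ∧ Disjoint p.1 p.2 ∧
    p.1.card = p.2.card ∧ 1 ≤ p.1.card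

theorem mem_balancedPairs {h : St N} {p : Finset (Fin N) × Finset (Fin N)} :
    p ∈ balancedPairs h ↔ p.1 ⊆ ones h ∧ p.2 ⊆ ones h ∧ Disjoint p.1 p.2 ∧
      p.1.card = p.2.card ∧ 1 ≤ p.1.card := by
  simp [balancedPairs]

theorem mem_ones {h : St N} {a : Fin N} : a ∈ ones h ↔ h a = 1 := by
  simp [ones]

theorem card_le_nhalf {h : St N} {p : Finset (Fin N) × Finset (Fin N)}
    (hp : p ∈ balancedPairs h) : p.1.card ≤ nhalf h := by
  obtain ⟨h1, h2, h3, h4, -⟩ := mem_balancedPairs.1 hp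
  have := Finset.card_le_card (Finset.union_subset h1 h2)
  rw [Finset.card_union_of_disjoint h3] at this
  unfold nhalf
  omega

theorem sum_eq_sum_balancedPairs {M : Type*} [AddCommGroup M] [Module ℂ M] (c : ℂ) (h : St N)
    (f : Finset (Fin N) → Finset (Fin N) → M) :
    ∑ r ∈ Finset.Icc 1 (nhalf h), c ^ r •
      ∑ α : Finset (Fin N), ∑ β : Finset (Fin N),
        (if α ⊆ ones h ∧ β ⊆ ones h ∧ Disjoint α β ∧ α.card = r ∧ β.card = r then
          f α β else 0) =
      ∑ p ∈ balancedPairs h, c ^ p.1.card • f p.1 p.2 := by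
  rw [← Finset.sum_fiberwise_of_maps_to (g := fun p => p.1.card) (t := Finset.Icc 1 (nhalf h))
    (fun p hp => Finset.mem_Icc.2 ⟨(mem_balancedPairs.1 hp).2.2.2.2, card_le_nhalf hp⟩)]
  refine Finset.sum_congr rfl fun r hr => ?_
  have hr1 := (Finset.mem_Icc.1 hr).1
  rw [← Fintype.sum_prod_type' (fun α β => if α ⊆ ones h ∧ β ⊆ ones h ∧ Disjoint α β ∧
    α.card = r ∧ β.card = r then f α β else 0), ← Finset.sum_filter, Finset.smul_sum]
  refine Finset.sum_congr ?_ ?_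
  · ext p
    simp only [balancedPairs, Finset.mem_filter, Finset.mem_univ, true_and]
    constructor
    · rintro ⟨h1, h2, h3, h4, h5⟩
      exact ⟨⟨h1, h2, h3, by omega, by omega⟩, h4⟩
    · rintro ⟨⟨h1, h2, h3, h4, h5⟩, h6⟩
      exact ⟨h1, h2, h3, h6, by omega⟩
  · intro p hp
    rw [Finset.mem_filter] at hp
    rw [hp.2]

theorem kab_eq_zero_iff {h : St N} {α β : Finset (Fin N)}
    (a : Fin N) (ha : h a = 1) : kab h α β a = 0 ↔ a ∈ α := by
  unfold kab
  split_ifs <;> simp_all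

theorem kab_eq_two_iff {h : St N} {α β : Finset (Fin N)} (hd : Disjoint α β)
    (a : Fin N) (ha : h a = 1) : kab h α β a = 2 ↔ a ∈ β := by
  have : a ∈ α → a ∉ β := fun h' => Finset.disjoint_left.1 hd h'
  unfold kab
  split_ifs <;> simp_all

theorem ones_kab {h : St N} {α β : Finset (Fin N)} :
    ones (kab h α β) = ones h \ (α ∪ β) := by
  ext a
  simp only [mem_ones, kab, Finset.mem_sdiff, Finset.mem_union]
  split_ifs <;> simp_all

theorem kab_kab (h : St N) {α β α' β' : Finset (Fin N)} (hd : Disjoint α β') :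
    kab (kab h α β) α' β' = kab h (α ∪ α') (β ∪ β') := by
  funext a
  have : a ∈ α → a ∉ β' := fun h' => Finset.disjoint_left.1 hd h'
  simp only [kab, Finset.mem_union]
  split_ifs <;> simp_all

theorem kab_injOn {h : St N} {p q : Finset (Fin N) × Finset (Fin N)}
    (hp : p ∈ balancedPairs h) (hq : q ∈ balancedPairs h)
    (e : kab h p.1 p.2 = kab h q.1 q.2) : p = q := by
  obtain ⟨p1, p2, p3, -, -⟩ := mem_balancedPairs.1 hp
  obtain ⟨q1, q2, q3, -, -⟩ := mem_balancedPairs.1 hq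
  refine Prod.ext (Finset.ext fun a => ?_) (Finset.ext fun a => ?_)
  · by_cases ha : h a = 1
    · rw [← kab_eq_zero_iff a ha, e, kab_eq_zero_iff a ha]
    · exact iff_of_false (fun h' => ha (mem_ones.1 (p1 h'))) fun h' => ha (mem_ones.1 (q1 h'))
  · by_cases ha : h a = 1
    · rw [← kab_eq_two_iff p3 a ha, e, kab_eq_two_iff q3 a ha]
    · exact iff_of_false (fun h' => ha (mem_ones.1 (p2 h'))) fun h' => ha (mem_ones.1 (q2 h'))

theorem kab_ne_self {h : St N} {p : Finset (Fin N) × Finset (Fin N)}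
    (hp : p ∈ balancedPairs h) : h ≠ kab h p.1 p.2 := by
  obtain ⟨p1, -, -, -, p5⟩ := mem_balancedPairs.1 hp
  obtain ⟨a, ha⟩ := Finset.card_pos.1 p5
  intro e
  have h1 := mem_ones.1 (p1 ha)
  have h0 := (kab_eq_zero_iff (β := p.2) a h1).2 ha
  rw [← e, h1] at h0
  exact one_ne_zero h0

/-- Two successive replacements by balanced pairs amount to a single one. -/
theorem union_mem_balancedPairs {h : St N} {p q : Finset (Fin N) × Finset (Fin N)}
    (hp : p ∈ balancedPairs h) (hq : q ∈ balancedPairs (kab h p.1 p.2)) :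
    (p.1 ∪ q.1, p.2 ∪ q.2) ∈ balancedPairs h ∧
      kab (kab h p.1 p.2) q.1 q.2 = kab h (p.1 ∪ q.1) (p.2 ∪ q.2) ∧
      (p.1 ∪ q.1).card = p.1.card + q.1.card := by
  obtain ⟨p1, p2, p3, p4, p5⟩ := mem_balancedPairs.1 hp
  obtain ⟨q1, q2, q3, q4, q5⟩ := mem_balancedPairs.1 hq
  rw [ones_kab, Finset.subset_sdiff, Finset.disjoint_union_right] at q1 q2
  have c1 := Finset.card_union_of_disjoint q1.2.1.symm
  have c2 := Finset.card_union_of_disjoint q2.2.2.symm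
  refine ⟨mem_balancedPairs.2 ⟨Finset.union_subset p1 q1.1, Finset.union_subset p2 q2.1, ?_,
    by simp only; omega, by simp only; omega⟩, kab_kab h q2.2.1.symm, c1⟩
  simp only [Finset.disjoint_union_left, Finset.disjoint_union_right]
  exact ⟨⟨p3, q1.2.2⟩, q2.2.1.symm, q3⟩

theorem sdiff_mem_balancedPairs {h : St N} {p q : Finset (Fin N) × Finset (Fin N)}
    (hp : p ∈ balancedPairs h) (hq : q ∈ balancedPairs h) (h1 : p.1 ⊆ q.1) (h2 : p.2 ⊆ q.2)
    (hc : p.1.card < q.1.card) :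
    (q.1 \ p.1, q.2 \ p.2) ∈ balancedPairs (kab h p.1 p.2) := by
  obtain ⟨p1, p2, p3, p4, p5⟩ := mem_balancedPairs.1 hp
  obtain ⟨q1, q2, q3, q4, q5⟩ := mem_balancedPairs.1 hq
  have c1 := Finset.card_sdiff_of_subset h1
  have c2 := Finset.card_sdiff_of_subset h2
  refine mem_balancedPairs.2 ⟨?_, ?_, q3.mono Finset.sdiff_subset Finset.sdiff_subset,
    by simp only; omega, by simp only; omega⟩
  · simp only
    rw [ones_kab, Finset.subset_sdiff, Finset.disjoint_union_right]
    exact ⟨Finset.sdiff_subset.trans q1, Finset.sdiff_disjoint,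
      q3.mono Finset.sdiff_subset h2⟩
  · simp only
    rw [ones_kab, Finset.subset_sdiff, Finset.disjoint_union_right]
    exact ⟨Finset.sdiff_subset.trans q2, (q3.mono h1 Finset.sdiff_subset).symm,
      Finset.sdiff_disjoint⟩

/-- The sum multiplying `C_k^h` in the pseudo-orthogonality relations. -/
def overlap (c : ℂ) (k h : St N) : ℂ :=
  ∑ p ∈ balancedPairs h, c ^ p.1.card * (if k = kab h p.1 p.2 then 1 else 0)

theorem overlap_eq_zero {c : ℂ} {k h : St N}
    (hk : ∀ p ∈ balancedPairs h, k ≠ kab h p.1 p.2) : overlap c k h = 0 :=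
  Finset.sum_eq_zero fun p hp => by rw [if_neg (hk p hp), mul_zero]

theorem overlap_kab (c : ℂ) {h : St N} {p : Finset (Fin N) × Finset (Fin N)}
    (hp : p ∈ balancedPairs h) : overlap c (kab h p.1 p.2) h = c ^ p.1.card := by
  rw [overlap, Finset.sum_eq_single_of_mem p hp, if_pos rfl, mul_one]
  intro q hq hqp
  rw [if_neg fun e => hqp (kab_injOn hq hp e.symm), mul_zero]

theorem overlap_kab_eq_zero {c : ℂ} {k h : St N} {p : Finset (Fin N) × Finset (Fin N)}
    (hp : p ∈ balancedPairs h) (hk : ∀ q ∈ balancedPairs h, k ≠ kab h q.1 q.2) :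
    overlap c k (kab h p.1 p.2) = 0 :=
  overlap_eq_zero fun q hq => by
    obtain ⟨h1, h2, -⟩ := union_mem_balancedPairs hp hq
    rw [h2]
    exact hk _ h1

theorem overlap_kab_kab (c : ℂ) {h : St N} {p q : Finset (Fin N) × Finset (Fin N)}
    (hp : p ∈ balancedPairs h) (hq : q ∈ balancedPairs h) :
    overlap c (kab h q.1 q.2) (kab h p.1 p.2) =
      if p.1 ⊆ q.1 ∧ p.2 ⊆ q.2 ∧ p.1.card < q.1.card then c ^ (q.1.card - p.1.card) else 0 := by
  split_ifs with hpq
  · obtain ⟨h1, h2, hc⟩ := hpq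
    have hs := sdiff_mem_balancedPairs hp hq h1 h2 hc
    have e := (union_mem_balancedPairs hp hs).2.1
    simp only [Finset.union_sdiff_of_subset h1, Finset.union_sdiff_of_subset h2] at e
    rw [← e, ← Finset.card_sdiff_of_subset h1]
    have hO := overlap_kab c hs
    exact hO
  · refine overlap_eq_zero fun s hs e => hpq ?_
    obtain ⟨h1, h2, h3⟩ := union_mem_balancedPairs hp hs
    have := (mem_balancedPairs.1 hs).2.2.2.2
    rw [h2] at e
    obtain rfl := kab_injOn hq h1 e
    exact ⟨Finset.subset_union_left, Finset.subset_union_left, by simp only; omega⟩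

/-- The coefficients `B_{α,β,h}` built by recursion from the norms `n` and the
coefficients `C`. -/
def bcoef (n : St N → ℂ) (C : St N → St N → ℂ) (h : St N) (α β : Finset (Fin N)) : ℂ :=
  -((n h / n (kab h α β) * C (kab h α β) h) +
    ∑ α' : Finset (Fin N), ∑ β' : Finset (Fin N),
      (if _hc : α' ⊆ α ∧ β' ⊆ β ∧ 1 ≤ α'.card ∧ α'.card = β'.card ∧
          α'.card ≤ α.card - 1 then
        bcoef n C h α' β' *
          (n (kab h α' β') / n (kab h α β) * C (kab h α β) (kab h α' β'))
      else 0))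
termination_by α.card
decreasing_by omega

/-- The recursion for `bcoef`, as a sum over balanced pairs. -/
theorem mul_bcoef {n : St N → ℂ} (hn : ∀ h, n h ≠ 0) (C : St N → St N → ℂ) {h : St N}
    {q : Finset (Fin N) × Finset (Fin N)} (hq : q ∈ balancedPairs h) :
    n (kab h q.1 q.2) * bcoef n C h q.1 q.2 =
      -(n h * C (kab h q.1 q.2) h + ∑ p ∈ balancedPairs h,
        (if p.1 ⊆ q.1 ∧ p.2 ⊆ q.2 ∧ p.1.card < q.1.card then
          bcoef n C h p.1 p.2 * (n (kab h p.1 p.2) * C (kab h q.1 q.2) (kab h p.1 p.2))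
        else 0)) := by
  obtain ⟨q1, q2, q3, q4, q5⟩ := mem_balancedPairs.1 hq
  have hnq := hn (kab h q.1 q.2)
  rw [bcoef, mul_neg, mul_add]
  congr 2
  · field_simp
  rw [← Fintype.sum_prod_type' (fun α' β' => if _hc : α' ⊆ q.1 ∧ β' ⊆ q.2 ∧ 1 ≤ α'.card ∧
      α'.card = β'.card ∧ α'.card ≤ q.1.card - 1 then bcoef n C h α' β' *
        (n (kab h α' β') / n (kab h q.1 q.2) * C (kab h q.1 q.2) (kab h α' β')) else 0),
    balancedPairs, Finset.sum_filter, Finset.mul_sum]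
  refine Finset.sum_congr rfl fun p _ => ?_
  by_cases hp : p.1 ⊆ q.1 ∧ p.2 ⊆ q.2 ∧ 1 ≤ p.1.card ∧ p.1.card = p.2.card ∧
      p.1.card ≤ q.1.card - 1
  · obtain ⟨h1, h2, h3, h4, h5⟩ := hp
    rw [dif_pos ⟨h1, h2, h3, h4, h5⟩,
      if_pos ⟨h1.trans q1, h2.trans q2, q3.mono h1 h2, h4, h3⟩, if_pos ⟨h1, h2, by omega⟩]
    field_simp
  · rw [dif_neg hp, mul_zero]
    split_ifs with h1 h2
    · exact absurd ⟨h2.1, h2.2.1, h1.2.2.2.2, h1.2.2.2.1, by omega⟩ hp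
    all_goals rfl

/-- The combination of pseudo-orthogonal couplings with coefficients `bcoef` is diagonal. -/
theorem sum_bcoef_mul_overlap {n : St N → ℂ} (hn : ∀ h, n h ≠ 0) (C : St N → St N → ℂ) (c : ℂ)
    (k h : St N) :
    n h * ((if k = h then 1 else 0) + C k h * overlap c k h) +
      ∑ p ∈ balancedPairs h, c ^ p.1.card * (bcoef n C h p.1 p.2 *
        (n (kab h p.1 p.2) * ((if k = kab h p.1 p.2 then 1 else 0) +
          C k (kab h p.1 p.2) * overlap c k (kab h p.1 p.2)))) =
      if k = h then n h else 0 := by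
  by_cases hk : ∃ q ∈ balancedPairs h, k = kab h q.1 q.2
  · obtain ⟨q, hq, rfl⟩ := hk
    have hne := (kab_ne_self hq).symm
    rw [if_neg hne, if_neg hne, overlap_kab c hq]
    have key : ∀ p ∈ balancedPairs h, c ^ p.1.card * (bcoef n C h p.1 p.2 *
        (n (kab h p.1 p.2) * ((if kab h q.1 q.2 = kab h p.1 p.2 then 1 else 0) +
          C (kab h q.1 q.2) (kab h p.1 p.2) *
            overlap c (kab h q.1 q.2) (kab h p.1 p.2)))) =
        (if p = q then c ^ q.1.card * (n (kab h q.1 q.2) * bcoef n C h q.1 q.2) else 0) +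
        c ^ q.1.card * (if p.1 ⊆ q.1 ∧ p.2 ⊆ q.2 ∧ p.1.card < q.1.card then
          bcoef n C h p.1 p.2 * (n (kab h p.1 p.2) * C (kab h q.1 q.2) (kab h p.1 p.2))
        else 0) := by
      intro p hp
      rw [overlap_kab_kab c hp hq]
      by_cases hpq : p = q
      · subst hpq
        simp only [lt_irrefl, and_false, if_true, if_false]
        ring
      · rw [if_neg fun e => hpq (kab_injOn hp hq e.symm), if_neg hpq]
        split_ifs with hs
        · rw [← Nat.add_sub_cancel' hs.2.2.le, pow_add, Nat.add_sub_cancel_left]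
          ring
        · ring
    rw [Finset.sum_congr rfl key, Finset.sum_add_distrib, Finset.sum_ite_eq' _ q, if_pos hq,
      ← Finset.mul_sum, mul_bcoef hn C hq]
    ring
  · push Not at hk
    rw [overlap_eq_zero hk, Finset.sum_eq_zero]
    · split_ifs <;> ring
    · intro p hp
      rw [if_neg (hk p hp), overlap_kab_eq_zero hp hk]
      ring

theorem pair_add (L v w : Hsp N) : pair L (v + w) = pair L v + pair L w := by
  simp [pair, mul_add, Finset.sum_add_distrib]

theorem pair_smul (L : Hsp N) (c : ℂ) (v : Hsp N) : pair L (c • v) = c * pair L v := by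
  simp [pair, Finset.mul_sum, mul_left_comm]

theorem pair_sum {ι : Type*} (L : Hsp N) (s : Finset ι) (f : ι → Hsp N) :
    pair L (∑ i ∈ s, f i) = ∑ i ∈ s, pair L (f i) := by
  simp only [pair, Finset.sum_apply, Finset.mul_sum]
  exact Finset.sum_comm

/-- A vector is determined by its pairings with a spanning family of co-vectors. -/
theorem ext_pair {u : St N → Hsp N} (hu : Submodule.span ℂ (Set.range u) = ⊤) {v w : Hsp N}
    (h : ∀ k, pair (u k) v = pair (u k) w) : v = w := by
  have key : ∀ x : Hsp N, x ⬝ᵥ v = x ⬝ᵥ w := by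
    intro x
    have hx : x ∈ Submodule.span ℂ (Set.range u) := hu ▸ Submodule.mem_top
    induction hx using Submodule.span_induction with
    | mem x hx =>
      obtain ⟨k, rfl⟩ := hx
      exact h k
    | zero => simp
    | add x y _ _ hx hy => rw [add_dotProduct, add_dotProduct, hx, hy]
    | smul a x _ hx => rw [smul_dotProduct, smul_dotProduct, hx]
  funext f
  simpa using key (Pi.single f 1)

/-- expansion of the vectors `|h⟩_p` of the basis orthogonal to the SoV
co-vector basis over the SoV vector basis, with coefficients `B_{α,β,h}` determined by the
recursion in terms of the normalized pseudo-orthogonality coefficients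
`C̄_s^r = (⟨r|r⟩/⟨s|s⟩)·C_s^r`. -/
theorem statement_4 (N : ℕ) (η : ℂ) (hη : η ≠ 0) (ξ : Fin N → ℂ) (hξ : InhomCond η ξ)
    (K : Matrix (Fin 3) (Fin 3) ℂ) (hK : SimpleSpectrum K) (L R0 : Hsp N)
    (hbL : IsBasisFamily (sovCov η ξ K L))
    (hR0 : DualRef η ξ K L R0)
    (hbR : IsBasisFamily (sovVec η ξ K R0))
    (C : St N → St N → ℂ) (hCne : ∀ h k : St N, C h k ≠ 0)
    -- the pseudo-orthogonality relations with coefficients `C`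
    (hC : ∀ h k : St N,
      pair (sovCov η ξ K L h) (sovVec η ξ K R0 k) =
        pair (sovCov η ξ K L k) (sovVec η ξ K R0 k) *
          ((if h = k then 1 else 0) +
            C h k * ∑ r ∈ Finset.Icc 1 (nhalf k), K.det ^ r *
              ∑ α : Finset (Fin N), ∑ β : Finset (Fin N),
                (if α ⊆ ones k ∧ β ⊆ ones k ∧ Disjoint α β ∧
                    α.card = r ∧ β.card = r ∧ h = kab k α β then 1 else 0)))
    -- `Pv h = |h⟩_p` is the unique family with `⟨k|h⟩_p = δ_{k,h} ⟨h|h⟩`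
    (Pv : St N → Hsp N)
    (hPv : ∀ k h : St N,
      pair (sovCov η ξ K L k) (Pv h) =
        if k = h then pair (sovCov η ξ K L h) (sovVec η ξ K R0 h) else 0) :
    ∃ B : Finset (Fin N) → Finset (Fin N) → St N → ℂ,
      (∀ h : St N,
        Pv h = sovVec η ξ K R0 h +
          ∑ r ∈ Finset.Icc 1 (nhalf h), K.det ^ r •
            ∑ α : Finset (Fin N), ∑ β : Finset (Fin N),
              (if α ⊆ ones h ∧ β ⊆ ones h ∧ Disjoint α β ∧ α.card = r ∧ β.card = r then
                B α β h • sovVec η ξ K R0 (kab h α β) else 0)) ∧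
      (∀ (h : St N) (α β : Finset (Fin N)),
        α ⊆ ones h → β ⊆ ones h → Disjoint α β → α.card = β.card → 1 ≤ α.card →
        B α β h =
          -((pair (sovCov η ξ K L h) (sovVec η ξ K R0 h) /
              pair (sovCov η ξ K L (kab h α β)) (sovVec η ξ K R0 (kab h α β)) *
              C (kab h α β) h) +
            ∑ α' : Finset (Fin N), ∑ β' : Finset (Fin N),
              (if α' ⊆ α ∧ β' ⊆ β ∧ 1 ≤ α'.card ∧ α'.card = β'.card ∧
                  α'.card ≤ α.card - 1 then
                B α' β' h *
                  (pair (sovCov η ξ K L (kab h α' β')) (sovVec η ξ K R0 (kab h α' β')) /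
                    pair (sovCov η ξ K L (kab h α β)) (sovVec η ξ K R0 (kab h α β)) *
                    C (kab h α β) (kab h α' β'))
              else 0))) := by
  set n : St N → ℂ := fun h => pair (sovCov η ξ K L h) (sovVec η ξ K R0 h) with hn_def
  have hn : ∀ h, n h ≠ 0 := by
    intro h h0
    refine hbR.1.ne_zero h (ext_pair hbL.2 fun k => ?_)
    have h0' : pair (sovCov η ξ K L h) (sovVec η ξ K R0 h) = 0 := h0
    rw [hC, h0', zero_mul]
    simp [pair]
  have hO : ∀ k h : St N, pair (sovCov η ξ K L k) (sovVec η ξ K R0 h) =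
      n h * ((if k = h then 1 else 0) + C k h * overlap K.det k h) := by
    intro k h
    have := sum_eq_sum_balancedPairs K.det h fun α β => if k = kab h α β then (1 : ℂ) else 0
    simp only [← ite_and, smul_eq_mul, and_assoc] at this
    rw [hC, this]
    rfl
  refine ⟨fun α β h => bcoef n C h α β, fun h => ?_, fun h α β _ _ _ _ _ => ?_⟩
  · refine ext_pair hbL.2 fun k => ?_
    rw [sum_eq_sum_balancedPairs K.det h fun α β =>
      bcoef n C h α β • sovVec η ξ K R0 (kab h α β), hPv, pair_add, pair_sum]
    simp only [pair_smul, hO k]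
    rw [sum_bcoef_mul_overlap hn]
  · simp only
    rw [bcoef]
    simp only [hn_def, dite_eq_ite]

end
end SoV
end
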